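/- Fix a real s > 1, an irrational ω = (ω₁, ω₂), and N ∈ ℕ. Then there exists a constant c > 0, depending only on s, with the following property. For every u⁰ ∈ h^s(ℤ²) there exist T > 0 with T ≥ c · ‖u⁰‖_s^{−2} and a unique continuous u : [0, T] → h^s(ℤ²) with u(0) = u⁰ which solves the truncated resonant system at height N on [0, T] (i.e., each coordinate t ↦ u_k(t) is differentiable and the system of ODEs holds, with both sums converging absolutely, for all t ∈ [0, T] and all k ∈ ℤ²). Moreover each coordinate function t ↦ u_k(t) is real-analytic on [0, T], and there exist constants C > 0 and R > 0 such that for all k ∈ ℤ², all n ∈ ℕ, and all τ ∈ [0, T], the n-th derivative satisfies |(d/dt)ⁿ u_k(τ)| ≤ C · Rⁿ · n!. -/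

import Mathlib

open scoped ComplexConjugate

/-- `ω = (ω₁, ω₂)` is irrational: `ω₁m₁ + ω₂m₂ ≠ 0` for every nonzero `(m₁, m₂) ∈ ℤ²`. -/
def IsIrrationalPair (ω : ℝ × ℝ) : Prop :=
  ∀ m : ℤ × ℤ, m ≠ 0 → ω.1 * (m.1 : ℝ) + ω.2 * (m.2 : ℝ) ≠ 0

/-- The frequency `λ_k = ω₁(k⁽¹⁾)² + ω₂(k⁽²⁾)²` for `k ∈ ℤ²`. -/
noncomputable def freq (ω : ℝ × ℝ) (k : ℤ × ℤ) : ℝ :=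
  ω.1 * (k.1 : ℝ) ^ 2 + ω.2 * (k.2 : ℝ) ^ 2

/-- The squared Euclidean norm `|k|² = (k⁽¹⁾)² + (k⁽²⁾)²` of `k ∈ ℤ²`. -/
def enormSq (k : ℤ × ℤ) : ℤ := k.1 ^ 2 + k.2 ^ 2

/-- The set `R^N(k)` of resonant triples at height `N`:
`(k₁, k₂, k₃)` with `(k₁, k₂, k₃, k) ∈ R` and `|k₁|, |k₂|, |k₃|, |k| ≤ N`. -/
def RNset (ω : ℝ × ℝ) (N : ℕ) (k : ℤ × ℤ) : Set ((ℤ × ℤ) × (ℤ × ℤ) × (ℤ × ℤ)) :=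
  {p | p.1 + p.2.1 = p.2.2 + k ∧
    freq ω p.1 + freq ω p.2.1 = freq ω p.2.2 + freq ω k ∧
    enormSq p.1 ≤ (N : ℤ) ^ 2 ∧ enormSq p.2.1 ≤ (N : ℤ) ^ 2 ∧
    enormSq p.2.2 ≤ (N : ℤ) ^ 2 ∧ enormSq k ≤ (N : ℤ) ^ 2}

/-- The set `W^N(k)` of weakly resonant triples at height `N`:
`k₁ + k₂ = k₃ + k`, `|λ_{k₁} + λ_{k₂} − λ_{k₃} − λ_k| ≤ 1`, and `|k₁| > N` or `|k₃| > N`. -/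
def WNset (ω : ℝ × ℝ) (N : ℕ) (k : ℤ × ℤ) : Set ((ℤ × ℤ) × (ℤ × ℤ) × (ℤ × ℤ)) :=
  {p | p.1 + p.2.1 = p.2.2 + k ∧
    |freq ω p.1 + freq ω p.2.1 - freq ω p.2.2 - freq ω k| ≤ 1 ∧
    ((N : ℤ) ^ 2 < enormSq p.1 ∨ (N : ℤ) ^ 2 < enormSq p.2.2)}

/-- The cubic monomial `x_{k₁} · x_{k₂} · conj(x_{k₃})` attached to a triple. -/
noncomputable def monom (x : ℤ × ℤ → ℂ) (p : (ℤ × ℤ) × (ℤ × ℤ) × (ℤ × ℤ)) : ℂ :=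
  x p.1 * x p.2.1 * conj (x p.2.2)

/-- The oscillating factor `exp(i(λ_{k₁} + λ_{k₂} − λ_{k₃} − λ_k)t)`. -/
noncomputable def oscFactor (ω : ℝ × ℝ) (k : ℤ × ℤ)
    (p : (ℤ × ℤ) × (ℤ × ℤ) × (ℤ × ℤ)) (t : ℝ) : ℂ :=
  Complex.exp (Complex.I *
    ((freq ω p.1 + freq ω p.2.1 - freq ω p.2.2 - freq ω k : ℝ) : ℂ) * (t : ℂ))

/-- `u` solves the truncated resonant system at height `N` on `[0, T]`: for each
`t ∈ [0, T]` and `k ∈ ℤ²`, both sums converge absolutely and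
`i·(d/dt)u_k(t) = ∑_{R^N(k)} u_{k₁}u_{k₂}conj(u_{k₃})
 + ∑_{W^N(k)} u_{k₁}u_{k₂}conj(u_{k₃}) e^{i(λ_{k₁}+λ_{k₂}−λ_{k₃}−λ_k)t}`. -/
def SolvesTruncated (ω : ℝ × ℝ) (N : ℕ) (T : ℝ) (u : ℝ → (ℤ × ℤ) → ℂ) : Prop :=
  ∀ t ∈ Set.Icc (0 : ℝ) T, ∀ k : ℤ × ℤ,
    Summable (fun p : RNset ω N k => ‖monom (u t) p.1‖) ∧
    Summable (fun p : WNset ω N k => ‖monom (u t) p.1‖) ∧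
    HasDerivWithinAt (fun τ => u τ k)
      (-Complex.I * ((∑' p : RNset ω N k, monom (u t) p.1) +
        ∑' p : WNset ω N k, monom (u t) p.1 * oscFactor ω k p.1 t))
      (Set.Icc (0 : ℝ) T) t

/-- The Sobolev weight `(1 + |n|²)^s` for `n ∈ ℤ²`. -/
noncomputable def hsWeight (s : ℝ) (n : ℤ × ℤ) : ℝ :=
  (1 + (n.1 : ℝ) ^ 2 + (n.2 : ℝ) ^ 2) ^ s

/-- Membership in `h^s(ℤ²)`: `∑ₙ |xₙ|² (1 + |n|²)^s < ∞`. -/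
def InHs (s : ℝ) (x : ℤ × ℤ → ℂ) : Prop :=
  Summable (fun n : ℤ × ℤ => ‖x n‖ ^ 2 * hsWeight s n)

/-- The `h^s(ℤ²)` norm `‖x‖_s = (∑ₙ |xₙ|² (1 + |n|²)^s)^{1/2}`. -/
noncomputable def hsNorm (s : ℝ) (x : ℤ × ℤ → ℂ) : ℝ :=
  Real.sqrt (∑' n : ℤ × ℤ, ‖x n‖ ^ 2 * hsWeight s n)

/-- Continuity of `u : [0, T] → h^s(ℤ²)` in the `h^s` norm. -/
def HsContOn (s T : ℝ) (u : ℝ → (ℤ × ℤ) → ℂ) : Prop :=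
  ∀ t ∈ Set.Icc (0 : ℝ) T, ∀ ε > (0 : ℝ), ∃ δ > (0 : ℝ),
    ∀ t' ∈ Set.Icc (0 : ℝ) T, |t' - t| < δ →
      hsNorm s (fun k => u t' k - u t k) < ε

/-- `f' : [0, T] → h^s(ℤ²)` is the derivative of `f : [0, T] → h^s(ℤ²)` in the
`h^s` norm, at every point of `[0, T]`. -/
def HsDerivOn (s T : ℝ) (f f' : ℝ → (ℤ × ℤ) → ℂ) : Prop :=
  ∀ t ∈ Set.Icc (0 : ℝ) T, ∀ ε > (0 : ℝ), ∃ δ > (0 : ℝ),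
    ∀ t' ∈ Set.Icc (0 : ℝ) T, |t' - t| < δ →
      hsNorm s (fun k => f t' k - f t k - ((t' - t : ℝ) : ℂ) * f' t k) ≤ ε * |t' - t|

/-- The box `Q_M = {k ∈ ℤ² : max(|k⁽¹⁾|, |k⁽²⁾|) ≤ M}`. -/
def QBox (M : ℕ) : Set (ℤ × ℤ) := {k : ℤ × ℤ | max |k.1| |k.2| ≤ (M : ℤ)}

open scoped ENNReal NNReal

/-! ### Weighted `ℓ²` estimates with values in `ℝ≥0∞` -/

/-- Triples of lattice points. -/
abbrev Triple := (ℤ × ℤ) × (ℤ × ℤ) × (ℤ × ℤ)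

theorem ENNReal.two_mul_le_sq_add_sq (x y : ℝ≥0∞) : 2 * (x * y) ≤ x ^ 2 + y ^ 2 := by
  wlog h : x ≤ y generalizing x y
  · have := this y x (le_of_not_ge h)
    rwa [mul_comm x y, add_comm]
  obtain ⟨d, rfl⟩ := exists_add_of_le h
  calc 2 * (x * (x + d)) ≤ 2 * (x * (x + d)) + d ^ 2 := le_self_add
    _ = x ^ 2 + (x + d) ^ 2 := by ring

theorem ENNReal.tsum_mul_tsum {ι κ : Type*} (f : ι → ℝ≥0∞) (g : κ → ℝ≥0∞) :
    (∑' i, f i) * ∑' j, g j = ∑' i, ∑' j, f i * g j := by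
  simp_rw [ENNReal.tsum_mul_left, ENNReal.tsum_mul_right]

/-- Weighted Cauchy–Schwarz inequality for series. -/
theorem ENNReal.sq_tsum_mul_le {ι : Type*} (β A : ι → ℝ≥0∞) :
    (∑' i, β i * A i) ^ 2 ≤ (∑' i, β i) * ∑' i, β i * A i ^ 2 := by
  have h2 : 2 * (∑' i, β i * A i) ^ 2 ≤ 2 * ((∑' i, β i) * ∑' i, β i * A i ^ 2) := by
    calc 2 * (∑' i, β i * A i) ^ 2
        = ∑' i, ∑' j, β i * β j * (2 * (A i * A j)) := by
          rw [sq, ENNReal.tsum_mul_tsum, ← ENNReal.tsum_mul_left]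
          refine tsum_congr fun i => ?_
          rw [← ENNReal.tsum_mul_left]
          exact tsum_congr fun j => by ring
      _ ≤ ∑' i, ∑' j, β i * β j * (A i ^ 2 + A j ^ 2) := by
          gcongr with i j
          exact ENNReal.two_mul_le_sq_add_sq _ _
      _ = (∑' i, ∑' j, (β i * A i ^ 2) * β j) + ∑' i, ∑' j, β i * (β j * A j ^ 2) := by
          rw [← ENNReal.tsum_add]
          refine tsum_congr fun i => ?_
          rw [← ENNReal.tsum_add]
          exact tsum_congr fun j => by ring
      _ = 2 * ((∑' i, β i) * ∑' i, β i * A i ^ 2) := by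
          rw [← ENNReal.tsum_mul_tsum, ← ENNReal.tsum_mul_tsum]; ring
  exact (ENNReal.mul_le_mul_iff_right (by simp) (by simp)).1 h2

/-- Young's inequality `ℓ¹ * ℓ² ⊆ ℓ²`. -/
theorem ENNReal.tsum_sq_tsum_mul_le {ι J : Type*} (β : J → ℝ≥0∞) (A : ι → ℝ≥0∞)
    (e : J → ι → ι) (he : ∀ j, Function.Injective (e j)) :
    ∑' k, (∑' j, β j * A (e j k)) ^ 2 ≤ (∑' j, β j) ^ 2 * ∑' k, A k ^ 2 := by
  calc ∑' k, (∑' j, β j * A (e j k)) ^ 2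
      ≤ ∑' k, (∑' j, β j) * ∑' j, β j * A (e j k) ^ 2 := by
        gcongr with k
        exact ENNReal.sq_tsum_mul_le _ _
    _ = (∑' j, β j) * ∑' j, β j * ∑' k, A (e j k) ^ 2 := by
        rw [ENNReal.tsum_mul_left, ENNReal.tsum_comm]
        simp_rw [ENNReal.tsum_mul_left]
    _ ≤ (∑' j, β j) * ∑' j, β j * ∑' k, A k ^ 2 := by
        refine mul_le_mul' le_rfl (ENNReal.tsum_le_tsum fun j => mul_le_mul' le_rfl ?_)
        exact ENNReal.tsum_comp_le_tsum_of_injective (he j) (fun k => A k ^ 2)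
    _ = _ := by rw [ENNReal.tsum_mul_right]; ring

/-- The trilinear convolution `∑_{k₁ + k₂ = k₃ + k} a_{k₁} b_{k₂} c_{k₃}`. -/
noncomputable def triConv (a b c : ℤ × ℤ → ℝ≥0∞) (k : ℤ × ℤ) : ℝ≥0∞ :=
  ∑' p : Triple, if p.1 + p.2.1 = p.2.2 + k then a p.1 * b p.2.1 * c p.2.2 else 0

theorem triConv_eq_right (a b c : ℤ × ℤ → ℝ≥0∞) (k : ℤ × ℤ) :
    triConv a b c k = ∑' j : (ℤ × ℤ) × (ℤ × ℤ), (a j.1 * b j.2) * c (j.1 + j.2 - k) := by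
  unfold triConv
  rw [ENNReal.tsum_prod', ENNReal.tsum_prod (f := fun x y => (a x * b y) * c (x + y - k))]
  refine tsum_congr fun x => ?_
  rw [ENNReal.tsum_prod']
  refine tsum_congr fun y => ?_
  rw [tsum_eq_single (x + y - k)]
  · simp
  · intro z hz
    rw [if_neg]
    intro h
    exact hz (by rw [h]; abel)

theorem triConv_eq_left (a b c : ℤ × ℤ → ℝ≥0∞) (k : ℤ × ℤ) :
    triConv a b c k = ∑' j : (ℤ × ℤ) × (ℤ × ℤ), (b j.1 * c j.2) * a (j.2 + k - j.1) := by
  unfold triConv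
  rw [ENNReal.tsum_prod', ENNReal.tsum_comm]
  refine tsum_congr fun j => ?_
  rw [tsum_eq_single (j.2 + k - j.1)]
  · simp [mul_comm, mul_assoc, mul_left_comm]
  · intro z hz
    rw [if_neg]
    intro h
    exact hz (by simp only at h; rw [← h]; abel)

theorem triConv_swap (a b c : ℤ × ℤ → ℝ≥0∞) : triConv a b c = triConv b a c := by
  funext k
  rw [triConv_eq_right, triConv_eq_right]
  rw [← (Equiv.prodComm (ℤ × ℤ) (ℤ × ℤ)).tsum_eq]
  refine tsum_congr fun j => ?_
  simp only [Equiv.prodComm_apply, Prod.fst_swap, Prod.snd_swap]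
  rw [mul_comm (a _), add_comm j.2]

theorem tsum_triConv_sq_le_right (a b c : ℤ × ℤ → ℝ≥0∞) :
    ∑' k, triConv a b c k ^ 2 ≤ (∑' k, a k) ^ 2 * (∑' k, b k) ^ 2 * ∑' k, c k ^ 2 := by
  simp_rw [triConv_eq_right]
  refine (ENNReal.tsum_sq_tsum_mul_le (fun j : (ℤ × ℤ) × (ℤ × ℤ) => a j.1 * b j.2) c
    (fun j k => j.1 + j.2 - k) fun j => sub_right_injective).trans_eq ?_
  rw [ENNReal.tsum_prod (f := fun x y => a x * b y), ← ENNReal.tsum_mul_tsum, mul_pow]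

theorem tsum_triConv_sq_le_left (a b c : ℤ × ℤ → ℝ≥0∞) :
    ∑' k, triConv a b c k ^ 2 ≤ (∑' k, a k ^ 2) * (∑' k, b k) ^ 2 * (∑' k, c k) ^ 2 := by
  simp_rw [triConv_eq_left]
  refine (ENNReal.tsum_sq_tsum_mul_le (fun j : (ℤ × ℤ) × (ℤ × ℤ) => b j.1 * c j.2) a
    (fun j k => j.2 + k - j.1) fun j x y h => by simpa using h).trans_eq ?_
  rw [ENNReal.tsum_prod (f := fun x y => b x * c y), ← ENNReal.tsum_mul_tsum, mul_pow]
  ring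

theorem triConv_le (a b c : ℤ × ℤ → ℝ≥0∞) (k : ℤ × ℤ) :
    triConv a b c k ≤ (∑' k, a k) * (∑' k, b k) * ∑' k, c k := by
  have : ∑' p : Triple, a p.1 * b p.2.1 * c p.2.2
      = (∑' k, a k) * (∑' k, b k) * ∑' k, c k := by
    rw [ENNReal.tsum_prod', mul_assoc, ENNReal.tsum_mul_tsum b, ENNReal.tsum_mul_tsum]
    refine tsum_congr fun x => ?_
    rw [ENNReal.tsum_prod']
    simp_rw [← ENNReal.tsum_mul_left, mul_assoc]
  rw [← this]
  refine ENNReal.tsum_le_tsum fun p => ?_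
  split_ifs <;> simp

theorem tsum_triConv (a b c : ℤ × ℤ → ℝ≥0∞) :
    ∑' k, triConv a b c k = (∑' k, a k) * (∑' k, b k) * ∑' k, c k := by
  simp_rw [triConv_eq_left]
  rw [ENNReal.tsum_comm]
  simp_rw [ENNReal.tsum_mul_left]
  have (j : (ℤ × ℤ) × (ℤ × ℤ)) : ∑' k, a (j.2 + k - j.1) = ∑' k, a k := by
    rw [← (Equiv.addLeft (j.2 - j.1)).tsum_eq a]
    refine tsum_congr fun k => ?_
    simp only [Equiv.coe_addLeft]
    congr 1; abel
  simp_rw [this]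
  rw [ENNReal.tsum_mul_right, ENNReal.tsum_prod (f := fun x y => b x * c y),
    ← ENNReal.tsum_mul_tsum]
  ring

/-- The square root of the Sobolev weight, as an extended nonnegative real. -/
noncomputable def sobW (s : ℝ) (k : ℤ × ℤ) : ℝ≥0∞ := ENNReal.ofReal (hsWeight (s / 2) k)

/-- The squared `h^s` norm of a nonnegative sequence. -/
noncomputable def sobSq (s : ℝ) (a : ℤ × ℤ → ℝ≥0∞) : ℝ≥0∞ := ∑' k, (sobW s k * a k) ^ 2

theorem hsWeight_pos (s : ℝ) (k : ℤ × ℤ) : 0 < hsWeight s k := by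
  unfold hsWeight; positivity

theorem hsWeight_half_sq (s : ℝ) (k : ℤ × ℤ) : hsWeight (s / 2) k ^ 2 = hsWeight s k := by
  unfold hsWeight
  rw [← Real.rpow_natCast, ← Real.rpow_mul (by positivity)]
  norm_num

theorem sobW_ne_zero (s : ℝ) (k : ℤ × ℤ) : sobW s k ≠ 0 := by
  simp [sobW, hsWeight_pos]

theorem sobW_ne_top (s : ℝ) (k : ℤ × ℤ) : sobW s k ≠ ⊤ := by simp [sobW]

theorem sobW_sq (s : ℝ) (k : ℤ × ℤ) : sobW s k ^ 2 = ENNReal.ofReal (hsWeight s k) := by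
  rw [sobW, ← ENNReal.ofReal_pow (hsWeight_pos _ _).le, hsWeight_half_sq]

theorem hsWeight_le_of_add_eq {s : ℝ} (hs : 0 ≤ s) {k k₁ k₂ k₃ : ℤ × ℤ} (h : k₁ + k₂ = k₃ + k) :
    hsWeight s k ≤ 9 ^ s * (hsWeight s k₁ + hsWeight s k₂ + hsWeight s k₃) := by
  obtain rfl : k = k₁ + k₂ - k₃ := by rw [h]; abel
  have key : ∀ i : ℤ × ℤ, (0 : ℝ) ≤ 1 + (i.1 : ℝ) ^ 2 + (i.2 : ℝ) ^ 2 := fun i => by positivity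
  set q : ℤ × ℤ → ℝ := fun i => 1 + (i.1 : ℝ) ^ 2 + (i.2 : ℝ) ^ 2 with hq
  have h1 : q (k₁ + k₂ - k₃) ≤ 3 * (q k₁ + q k₂ + q k₃) := by
    simp only [hq, Prod.fst_sub, Prod.fst_add, Prod.snd_sub, Prod.snd_add]
    push_cast
    nlinarith [sq_nonneg ((k₁.1 : ℝ) - k₂.1), sq_nonneg ((k₁.1 : ℝ) + k₃.1),
      sq_nonneg ((k₂.1 : ℝ) + k₃.1), sq_nonneg ((k₁.2 : ℝ) - k₂.2),
      sq_nonneg ((k₁.2 : ℝ) + k₃.2), sq_nonneg ((k₂.2 : ℝ) + k₃.2)]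
  obtain ⟨i, hi, hmem⟩ : ∃ i, q (k₁ + k₂ - k₃) ≤ 9 * q i ∧
      hsWeight s i ≤ hsWeight s k₁ + hsWeight s k₂ + hsWeight s k₃ := by
    have p1 := (hsWeight_pos s k₁).le
    have p2 := (hsWeight_pos s k₂).le
    have p3 := (hsWeight_pos s k₃).le
    by_cases c1 : q k₂ ≤ q k₁ ∧ q k₃ ≤ q k₁
    · exact ⟨k₁, by linarith [c1.1, c1.2], by linarith⟩
    by_cases c2 : q k₁ ≤ q k₂ ∧ q k₃ ≤ q k₂
    · exact ⟨k₂, by linarith [c2.1, c2.2], by linarith⟩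
    · refine ⟨k₃, ?_, by linarith⟩
      grind
  calc hsWeight s (k₁ + k₂ - k₃) ≤ (9 * q i) ^ s := Real.rpow_le_rpow (key _) hi hs
    _ = 9 ^ s * hsWeight s i := Real.mul_rpow (by norm_num) (key _)
    _ ≤ _ := by gcongr

theorem summable_inv_hsWeight {s : ℝ} (hs : 1 < s) : Summable fun k => (hsWeight s k)⁻¹ := by
  have h1 : Summable fun k : ℤ × ℤ => ‖![k.1, k.2]‖ ^ (-(2 * s)) := by
    have := EisensteinSeries.summable_one_div_norm_rpow (k := 2 * s) (by linarith)
    exact this.comp_injective (i := fun k : ℤ × ℤ => ![k.1, k.2])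
      fun a b h => Prod.ext (by simpa using congrFun h 0) (by simpa using congrFun h 1)
  refine Summable.of_norm_bounded_eventually h1 ?_
  filter_upwards [(Set.finite_singleton (0 : ℤ × ℤ)).compl_mem_cofinite] with k hk
  have hk0 : 0 < ‖![k.1, k.2]‖ := by
    rw [norm_pos_iff]
    intro h
    exact hk (Prod.ext (by simpa using congrFun h 0) (by simpa using congrFun h 1))
  rw [Real.norm_of_nonneg (inv_nonneg.2 (hsWeight_pos s k).le), Real.rpow_neg hk0.le,
    Real.rpow_mul hk0.le]
  have hle : ‖![k.1, k.2]‖ ^ (2 : ℝ) ≤ 1 + (k.1 : ℝ) ^ 2 + (k.2 : ℝ) ^ 2 := by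
    rw [Real.rpow_two, ← Real.sqrt_le_sqrt_iff (by positivity), Real.sqrt_sq hk0.le]
    refine (pi_norm_le_iff_of_nonneg (by positivity)).2 fun i => ?_
    apply Real.le_sqrt_of_sq_le
    fin_cases i
    · simp [Int.norm_eq_abs]; nlinarith [sq_nonneg (k.2 : ℝ)]
    · simp [Int.norm_eq_abs]; positivity
  have : (0 : ℝ) < ‖![k.1, k.2]‖ ^ (2 : ℝ) := by positivity
  unfold hsWeight
  gcongr

/-- The embedding constant of `h^s` into `ℓ¹`. -/
noncomputable def embConst (s : ℝ) : ℝ≥0∞ := ∑' k, (sobW s k ^ 2)⁻¹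

theorem embConst_ne_top {s : ℝ} (hs : 1 < s) : embConst s ≠ ⊤ := by
  have h := (summable_inv_hsWeight hs).tsum_ofReal_ne_top
  unfold embConst
  simp_rw [sobW_sq]
  convert h using 3 with k
  rw [ENNReal.ofReal_inv_of_pos (hsWeight_pos s k)]

theorem sq_tsum_le_sobSq (s : ℝ) (a : ℤ × ℤ → ℝ≥0∞) :
    (∑' k, a k) ^ 2 ≤ embConst s * sobSq s a := by
  have h := ENNReal.sq_tsum_mul_le (fun k => (sobW s k ^ 2)⁻¹) (fun k => sobW s k ^ 2 * a k)
  have h0 (k) : sobW s k ^ 2 ≠ 0 := by simp [sobW_ne_zero]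
  have ht (k) : sobW s k ^ 2 ≠ ⊤ := by simp [sobW_ne_top]
  convert h using 1
  · simp_rw [← mul_assoc, ENNReal.inv_mul_cancel (h0 _) (ht _), one_mul]
  · unfold embConst sobSq
    congr 1
    refine tsum_congr fun k => ?_
    rw [mul_pow, mul_pow, sq (sobW s k ^ 2), ← mul_assoc, ← mul_assoc,
      ENNReal.inv_mul_cancel (h0 _) (ht _), one_mul]

theorem tsum_ne_top_of_sobSq {s : ℝ} (hs : 1 < s) {a : ℤ × ℤ → ℝ≥0∞} (ha : sobSq s a ≠ ⊤) :
    ∑' k, a k ≠ ⊤ := by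
  intro h
  have := sq_tsum_le_sobSq s a
  rw [h] at this
  simp [ENNReal.mul_eq_top, embConst_ne_top hs, ha] at this

theorem ENNReal.add_sq_le_two_mul (x y : ℝ≥0∞) : (x + y) ^ 2 ≤ 2 * (x ^ 2 + y ^ 2) := by
  calc (x + y) ^ 2 = x ^ 2 + y ^ 2 + 2 * (x * y) := by ring
    _ ≤ x ^ 2 + y ^ 2 + (x ^ 2 + y ^ 2) := by gcongr; exact ENNReal.two_mul_le_sq_add_sq _ _
    _ = _ := by ring

theorem ENNReal.add_add_sq_le_four_mul (x y z : ℝ≥0∞) :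
    (x + y + z) ^ 2 ≤ 4 * (x ^ 2 + y ^ 2 + z ^ 2) := by
  calc (x + y + z) ^ 2 ≤ 2 * (2 * (x ^ 2 + y ^ 2) + z ^ 2) :=
        (ENNReal.add_sq_le_two_mul _ _).trans (by gcongr; exact ENNReal.add_sq_le_two_mul _ _)
    _ ≤ 2 * (2 * (x ^ 2 + y ^ 2) + z ^ 2) + 2 * z ^ 2 := le_self_add
    _ = _ := by ring

theorem sobSq_mono {s : ℝ} {a b : ℤ × ℤ → ℝ≥0∞} (h : ∀ k, a k ≤ b k) :
    sobSq s a ≤ sobSq s b := by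
  unfold sobSq
  gcongr with k
  exact h k

theorem sobSq_const_mul (s : ℝ) (c : ℝ≥0∞) (a : ℤ × ℤ → ℝ≥0∞) :
    sobSq s (fun k => c * a k) = c ^ 2 * sobSq s a := by
  unfold sobSq
  rw [← ENNReal.tsum_mul_left]
  exact tsum_congr fun k => by ring

theorem sobSq_add_le (s : ℝ) (a b : ℤ × ℤ → ℝ≥0∞) :
    sobSq s (fun k => a k + b k) ≤ 2 * (sobSq s a + sobSq s b) := by
  unfold sobSq
  rw [← ENNReal.tsum_add, ← ENNReal.tsum_mul_left]
  gcongr with k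
  rw [mul_add]
  exact ENNReal.add_sq_le_two_mul _ _

theorem sobSq_add_add_le (s : ℝ) (a b c : ℤ × ℤ → ℝ≥0∞) :
    sobSq s (fun k => a k + b k + c k) ≤ 4 * (sobSq s a + sobSq s b + sobSq s c) := by
  unfold sobSq
  rw [← ENNReal.tsum_add, ← ENNReal.tsum_add, ← ENNReal.tsum_mul_left]
  gcongr with k
  rw [mul_add, mul_add]
  exact ENNReal.add_add_sq_le_four_mul _ _ _

/-- `h^s` is an algebra under convolution for `s > 1`. -/
theorem exists_sobSq_triConv_le {s : ℝ} (hs : 1 < s) :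
    ∃ κ : ℝ≥0∞, κ ≠ ⊤ ∧ ∀ a b c : ℤ × ℤ → ℝ≥0∞,
      sobSq s (triConv a b c) ≤ κ * sobSq s a * sobSq s b * sobSq s c := by
  set M : ℝ≥0∞ := ENNReal.ofReal (9 ^ (s / 2))
  set E := embConst s with hE
  refine ⟨M ^ 2 * 4 * 3 * E ^ 2, ?_, fun a b c => ?_⟩
  · have := embConst_ne_top hs
    finiteness
  let w (a : ℤ × ℤ → ℝ≥0∞) : ℤ × ℤ → ℝ≥0∞ := fun k => sobW s k * a k
  have hw (k) : sobW s k * triConv a b c k ≤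
      M * (triConv (w a) b c k + triConv a (w b) c k + triConv a b (w c) k) := by
    unfold triConv
    rw [← ENNReal.tsum_add, ← ENNReal.tsum_add, ← ENNReal.tsum_mul_left, ← ENNReal.tsum_mul_left]
    refine ENNReal.tsum_le_tsum fun p => ?_
    split_ifs with hp
    · have := hsWeight_le_of_add_eq (s := s / 2) (by linarith) hp
      have : sobW s k ≤ M * (sobW s p.1 + sobW s p.2.1 + sobW s p.2.2) := by
        unfold sobW
        have n1 := (hsWeight_pos (s / 2) p.1).le
        have n2 := (hsWeight_pos (s / 2) p.2.1).le
        have n3 := (hsWeight_pos (s / 2) p.2.2).le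
        rw [← ENNReal.ofReal_add n1 n2, ← ENNReal.ofReal_add (by positivity) n3,
          ← ENNReal.ofReal_mul (by positivity)]
        exact ENNReal.ofReal_le_ofReal this
      calc sobW s k * (a p.1 * b p.2.1 * c p.2.2)
          ≤ M * (sobW s p.1 + sobW s p.2.1 + sobW s p.2.2) * (a p.1 * b p.2.1 * c p.2.2) := by
            gcongr
        _ = _ := by simp only [w]; ring
    · simp
  have hA := sq_tsum_le_sobSq s a
  have hB := sq_tsum_le_sobSq s b
  have hC := sq_tsum_le_sobSq s c
  rw [← hE] at hA hB hC
  calc sobSq s (triConv a b c)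
      ≤ ∑' k, (M * (triConv (w a) b c k + triConv a (w b) c k + triConv a b (w c) k)) ^ 2 := by
        exact ENNReal.tsum_le_tsum fun k => pow_le_pow_left' (hw k) 2
    _ ≤ ∑' k, M ^ 2 * (4 * (triConv (w a) b c k ^ 2 + triConv a (w b) c k ^ 2
          + triConv a b (w c) k ^ 2)) := by
        gcongr with k
        rw [mul_pow]
        gcongr
        exact ENNReal.add_add_sq_le_four_mul _ _ _
    _ = M ^ 2 * (4 * (∑' k, triConv (w a) b c k ^ 2 + ∑' k, triConv (w b) a c k ^ 2
          + ∑' k, triConv a b (w c) k ^ 2)) := by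
        rw [ENNReal.tsum_mul_left, ENNReal.tsum_mul_left, ENNReal.tsum_add, ENNReal.tsum_add,
          triConv_swap a (w b)]
    _ ≤ M ^ 2 * (4 * (sobSq s a * (E * sobSq s b) * (E * sobSq s c)
          + sobSq s b * (E * sobSq s a) * (E * sobSq s c)
          + (E * sobSq s a) * (E * sobSq s b) * sobSq s c)) := by
        gcongr
        · exact (tsum_triConv_sq_le_left (w a) b c).trans
            (mul_le_mul' (mul_le_mul' le_rfl hB) hC)
        · exact (tsum_triConv_sq_le_left (w b) a c).trans
            (mul_le_mul' (mul_le_mul' le_rfl hA) hC)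
        · exact (tsum_triConv_sq_le_right a b (w c)).trans
            (mul_le_mul' (mul_le_mul' hA hB) le_rfl)
    _ = _ := by ring

/-! ### A fixed point theorem in `h^s` with values in a Banach space -/

theorem lp_enorm_sq {ι B : Type*} [NormedAddCommGroup B] (x : lp (fun _ : ι => B) 2) :
    ‖x‖ₑ ^ 2 = ∑' k, ‖x k‖ₑ ^ 2 := by
  have h := lp.hasSum_norm (p := 2) (by norm_num) x
  simp only [ENNReal.toReal_ofNat, Real.rpow_ofNat] at h
  have h2 := ENNReal.ofReal_tsum_of_nonneg (fun k => by positivity) h.summable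
  rw [h.tsum_eq, ENNReal.ofReal_pow (norm_nonneg _), ofReal_norm] at h2
  rw [h2]
  refine tsum_congr fun k => ?_
  rw [ENNReal.ofReal_pow (norm_nonneg _), ofReal_norm]

theorem exists_fixedPoint_of_cubic {X : Type*} [NormedAddCommGroup X] [CompleteSpace X]
    (Φ : X → X) {K : ℝ} (hK : 0 ≤ K)
    (hΦ : ∀ x y, ‖Φ x - Φ y‖ ≤ K * (‖x‖ ^ 2 + ‖y‖ ^ 2) * ‖x - y‖)
    (h : 16 * K * ‖Φ 0‖ ^ 2 ≤ 1) : ∃ x, Φ x = x := by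
  set r := ‖Φ 0‖ with hr
  have hr0 : 0 ≤ r := norm_nonneg _
  have hmem (x : X) : x ∈ Metric.closedBall (0 : X) (2 * r) ↔ ‖x‖ ≤ 2 * r := by simp
  have hmaps : Set.MapsTo Φ (Metric.closedBall 0 (2 * r)) (Metric.closedBall 0 (2 * r)) := by
    intro x hx
    rw [hmem] at hx ⊢
    have h1 := hΦ x 0
    simp only [norm_zero, sub_zero] at h1
    have h2 : ‖Φ x‖ ≤ ‖Φ x - Φ 0‖ + r := by
      simpa using norm_add_le (Φ x - Φ 0) (Φ 0)
    have h3 : K * (‖x‖ ^ 2 + 0 ^ 2) * ‖x‖ ≤ K * ((2 * r) ^ 2 + 0 ^ 2) * (2 * r) := by gcongr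
    nlinarith
  have hc : ContractingWith (1 / 2) (hmaps.restrict Φ _ _) := by
    refine ⟨by rw [← NNReal.coe_lt_coe]; norm_num, LipschitzWith.of_dist_le_mul ?_⟩
    rintro ⟨x, hx⟩ ⟨y, hy⟩
    rw [hmem] at hx hy
    simp only [Subtype.dist_eq, Set.MapsTo.val_restrict_apply, dist_eq_norm]
    refine (hΦ x y).trans (mul_le_mul_of_nonneg_right ?_ (norm_nonneg _))
    have : K * (‖x‖ ^ 2 + ‖y‖ ^ 2) ≤ K * ((2 * r) ^ 2 + (2 * r) ^ 2) := by gcongr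
    push_cast
    linarith
  obtain ⟨x, -, hx, -⟩ := hc.exists_fixedPoint' Metric.isClosed_closedBall.isComplete hmaps
    (x := 0) (by simp [hr0]) (edist_ne_top _ _)
  exact ⟨x, hx⟩

/-- The sequence with weighted coordinates `x`. -/
noncomputable def unweight {B : Type*} [NormedAddCommGroup B] [NormedSpace ℝ B] (s : ℝ)
    (x : ℤ × ℤ → B) (k : ℤ × ℤ) : B := (hsWeight (s / 2) k)⁻¹ • x k

theorem sobSq_unweight {B : Type*} [NormedAddCommGroup B] [NormedSpace ℝ B] (s : ℝ)
    (x : lp (fun _ : ℤ × ℤ => B) 2) :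
    sobSq s (fun k => ‖unweight s x k‖ₑ) = ‖x‖ₑ ^ 2 := by
  rw [lp_enorm_sq]
  refine tsum_congr fun k => ?_
  have h := hsWeight_pos (s / 2) k
  change (sobW s k * ‖(hsWeight (s / 2) k)⁻¹ • x k‖ₑ) ^ 2 = _
  rw [enorm_smul, ← mul_assoc, sobW, Real.enorm_eq_ofReal (inv_nonneg.2 h.le),
    ← ENNReal.ofReal_mul h.le, mul_inv_cancel₀ h.ne']
  simp

theorem exists_unweight_eq {B : Type*} [NormedAddCommGroup B] [NormedSpace ℝ B] (s : ℝ)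
    {y : ℤ × ℤ → B} (hy : sobSq s (fun k => ‖y k‖ₑ) ≠ ⊤) :
    ∃ x : lp (fun _ : ℤ × ℤ => B) 2, unweight s x = y := by
  refine ⟨⟨fun k => hsWeight (s / 2) k • y k, memℓp_gen ?_⟩, ?_⟩
  · have : Summable fun k => ‖‖hsWeight (s / 2) k • y k‖ ^ 2‖ := by
      apply tsum_enorm_ne_top_iff_summable_norm.1
      convert hy using 1
      refine tsum_congr fun k => ?_
      rw [enorm_pow, enorm_norm, enorm_smul, sobW,
        Real.enorm_eq_ofReal (hsWeight_pos (s / 2) k).le]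
    simpa using this
  · funext k
    simp [unweight, smul_smul, inv_mul_cancel₀ (hsWeight_pos (s / 2) k).ne']

/-- Solvability of cubic convolution equations `u = b + I(∑ τ(u, u, u))` in `h^s` with values in a
Banach space, for `I` Lipschitz with a small constant. -/
theorem exists_solution_of_cubic {s : ℝ} (hs : 1 < s) :
    ∃ κ : ℝ, 0 < κ ∧ ∀ {B : Type} [NormedAddCommGroup B] [NormedSpace ℝ B] [CompleteSpace B]
      (I : B → B) (ρ : ℝ≥0) (_ : I 0 = 0) (_ : LipschitzWith ρ I)
      (τ : ℤ × ℤ → Triple → B → B → B → B) (L : ℝ≥0)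
      (_ : ∀ k p, τ k p 0 0 0 = 0)
      (_ : ∀ k p a b c, p.1 + p.2.1 ≠ p.2.2 + k → τ k p a b c = 0)
      (_ : ∀ k p a b c a' b' c', ‖τ k p a b c - τ k p a' b' c'‖ₑ ≤
        L * (‖a - a'‖ₑ * ‖b‖ₑ * ‖c‖ₑ + ‖a'‖ₑ * ‖b - b'‖ₑ * ‖c‖ₑ + ‖a'‖ₑ * ‖b'‖ₑ * ‖c - c'‖ₑ))
      (b₀ : ℤ × ℤ → B) (A : ℝ) (_ : 0 ≤ A)
      (_ : sobSq s (fun k => ‖b₀ k‖ₑ) ≤ ENNReal.ofReal A) (_ : κ * (ρ * L * A) ≤ 1),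
      ∃ u : ℤ × ℤ → B, sobSq s (fun k => ‖u k‖ₑ) ≠ ⊤ ∧
        (∀ k, Summable fun p : Triple => τ k p (u p.1) (u p.2.1) (u p.2.2)) ∧
        ∀ k, u k = b₀ k + I (∑' p : Triple, τ k p (u p.1) (u p.2.1) (u p.2.2)) := by
  obtain ⟨κ, hκ, halg⟩ := exists_sobSq_triConv_le hs
  refine ⟨16 * √(48 * κ.toReal) + 1, by positivity, ?_⟩
  intro B _ _ _ I ρ hI0 hI τ L hτ0 hτs hτ b₀ A hA hb₀ hsmall
  let S (u : ℤ × ℤ → B) (k : ℤ × ℤ) : B := ∑' p : Triple, τ k p (u p.1) (u p.2.1) (u p.2.2)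
  have hsum {u : ℤ × ℤ → B} (hu : sobSq s (fun k => ‖u k‖ₑ) ≠ ⊤) (k) :
      Summable fun p : Triple => τ k p (u p.1) (u p.2.1) (u p.2.2) := by
    refine Summable.of_norm (tsum_enorm_ne_top_iff_summable_norm.1 ?_)
    have hle : ∑' p : Triple, ‖τ k p (u p.1) (u p.2.1) (u p.2.2)‖ₑ ≤
        L * triConv (fun k => ‖u k‖ₑ) (fun k => ‖u k‖ₑ) (fun k => ‖u k‖ₑ) k := by
      unfold triConv
      rw [← ENNReal.tsum_mul_left]
      refine ENNReal.tsum_le_tsum fun p => ?_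
      split_ifs with hp
      · simpa [hτ0] using hτ k p (u p.1) (u p.2.1) (u p.2.2) 0 0 0
      · simp [hτs k p _ _ _ hp]
    refine ne_top_of_le_ne_top ?_ (hle.trans (mul_le_mul' le_rfl (triConv_le _ _ _ k)))
    have := tsum_ne_top_of_sobSq hs hu
    finiteness
  have hdiff {u v : ℤ × ℤ → B} (hu : sobSq s (fun k => ‖u k‖ₑ) ≠ ⊤)
      (hv : sobSq s (fun k => ‖v k‖ₑ) ≠ ⊤) :
      sobSq s (fun k => ‖I (S u k) - I (S v k)‖ₑ) ≤ (ρ * L) ^ 2 * (48 * κ *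
        (sobSq s (fun k => ‖u k‖ₑ) + sobSq s (fun k => ‖v k‖ₑ)) ^ 2 *
          sobSq s (fun k => ‖u k - v k‖ₑ)) := by
    set d : ℤ × ℤ → ℝ≥0∞ := fun k => ‖u k - v k‖ₑ with hd
    set m : ℤ × ℤ → ℝ≥0∞ := fun k => ‖u k‖ₑ + ‖v k‖ₑ with hm
    have hpt (k) : ‖I (S u k) - I (S v k)‖ₑ ≤
        (ρ * L) * (triConv d m m k + triConv m d m k + triConv m m d k) := by
      have h1 : ‖I (S u k) - I (S v k)‖ₑ ≤ ρ * ‖S u k - S v k‖ₑ := by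
        simpa [edist_eq_enorm_sub] using hI (S u k) (S v k)
      refine h1.trans ?_
      rw [mul_assoc]
      gcongr
      rw [← (hsum hu k).tsum_sub (hsum hv k)]
      refine enorm_tsum_le_tsum_enorm.trans ?_
      unfold triConv
      rw [← ENNReal.tsum_add, ← ENNReal.tsum_add, ← ENNReal.tsum_mul_left]
      refine ENNReal.tsum_le_tsum fun p => ?_
      split_ifs with hp
      · refine (hτ k p _ _ _ _ _ _).trans ?_
        have hmu (k) : ‖u k‖ₑ ≤ m k := le_self_add
        have hmv (k) : ‖v k‖ₑ ≤ m k := le_add_self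
        gcongr
        exacts [hmu _, hmu _, hmv _, hmu _, hmv _, hmv _]
      · simp [hτs k p _ _ _ hp]
    have hQm : sobSq s m ≤ 2 * (sobSq s (fun k => ‖u k‖ₑ) + sobSq s (fun k => ‖v k‖ₑ)) :=
      sobSq_add_le _ _ _
    refine (sobSq_mono hpt).trans ?_
    rw [sobSq_const_mul]
    gcongr
    calc sobSq s (fun k => triConv d m m k + triConv m d m k + triConv m m d k)
        ≤ 4 * (sobSq s (triConv d m m) + sobSq s (triConv m d m) + sobSq s (triConv m m d)) :=
          sobSq_add_add_le _ _ _ _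
      _ ≤ 4 * (κ * sobSq s d * sobSq s m * sobSq s m + κ * sobSq s m * sobSq s d * sobSq s m +
            κ * sobSq s m * sobSq s m * sobSq s d) := by
          gcongr <;> apply halg
      _ = 12 * κ * sobSq s m ^ 2 * sobSq s d := by ring
      _ ≤ 12 * κ * (2 * (sobSq s (fun k => ‖u k‖ₑ) + sobSq s (fun k => ‖v k‖ₑ))) ^ 2 *
            sobSq s d := by gcongr
      _ = _ := by ring
  have hS0 (k) : S 0 k = 0 := by simp [S, hτ0]
  have hz : sobSq s (fun _ : ℤ × ℤ => ‖(0 : B)‖ₑ) = 0 := by simp [sobSq]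
  have hfin (x : lp (fun _ : ℤ × ℤ => B) 2) :
      sobSq s (fun k => ‖b₀ k + I (S (unweight s x) k)‖ₑ) ≠ ⊤ := by
    have hx : sobSq s (fun k => ‖unweight s x k‖ₑ) ≠ ⊤ := by
      rw [sobSq_unweight]; finiteness
    have h1 := hdiff hx (v := 0) (ne_of_eq_of_ne hz ENNReal.zero_ne_top)
    simp only [hS0, hI0, sub_zero, Pi.zero_apply, hz] at h1
    have h2 : sobSq s (fun k => ‖I (S (unweight s x) k)‖ₑ) ≠ ⊤ := by
      refine ne_top_of_le_ne_top ?_ h1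
      finiteness
    refine ne_top_of_le_ne_top ?_ ((sobSq_mono fun k => enorm_add_le _ _).trans
      (sobSq_add_le s _ _))
    have := ne_top_of_le_ne_top ENNReal.ofReal_ne_top hb₀
    finiteness
  choose Φ hΦ using fun x => exists_unweight_eq s (hfin x)
  set K : ℝ := ρ * L * √(48 * κ.toReal) with hK
  have hlip (x y) : ‖Φ x - Φ y‖ ≤ K * (‖x‖ ^ 2 + ‖y‖ ^ 2) * ‖x - y‖ := by
    have hx : sobSq s (fun k => ‖unweight s x k‖ₑ) ≠ ⊤ := by rw [sobSq_unweight]; finiteness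
    have hy : sobSq s (fun k => ‖unweight s y k‖ₑ) ≠ ⊤ := by rw [sobSq_unweight]; finiteness
    have h1 := hdiff hx hy
    have hsub (x y : lp (fun _ : ℤ × ℤ => B) 2) (k) :
        unweight s x k - unweight s y k = unweight s (x - y : lp (fun _ : ℤ × ℤ => B) 2) k := by
      simp [unweight, smul_sub]
    have h2 (k) : I (S (unweight s x) k) - I (S (unweight s y) k) =
        unweight s (Φ x - Φ y : lp (fun _ : ℤ × ℤ => B) 2) k := by
      rw [← hsub, hΦ, hΦ]
      exact (add_sub_add_left_eq_sub _ _ _).symm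
    simp_rw [h2, hsub, sobSq_unweight] at h1
    have h3 := ENNReal.toReal_mono (by finiteness) h1
    simp only [ENNReal.toReal_mul, ENNReal.toReal_pow, ENNReal.coe_toReal, toReal_enorm,
      ENNReal.toReal_ofNat] at h3
    rw [ENNReal.toReal_add (by finiteness) (by finiteness)] at h3
    simp only [ENNReal.toReal_pow, toReal_enorm] at h3
    refine le_of_sq_le_sq ?_ (by positivity)
    refine h3.trans_eq ?_
    have hs2 := Real.sq_sqrt (show 0 ≤ 48 * κ.toReal by positivity)
    simp only [hK, mul_pow]
    rw [hs2]
    ring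
  have hΦ0 : ‖Φ 0‖ ^ 2 ≤ A := by
    have h1 : sobSq s (fun k => ‖unweight s (Φ 0) k‖ₑ) ≤ ENNReal.ofReal A := by
      have h0 : unweight s ((0 : lp (fun _ : ℤ × ℤ => B) 2) : ℤ × ℤ → B) = 0 := by
        funext k; simp [unweight]
      refine (sobSq_mono fun k => ?_).trans hb₀
      rw [hΦ, h0]
      simp only [hS0, hI0, add_zero, le_refl]
    rw [sobSq_unweight] at h1
    simpa [hA] using ENNReal.toReal_mono (by finiteness) h1
  obtain ⟨x, hx⟩ := exists_fixedPoint_of_cubic Φ (by positivity) hlip (by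
    have hA0 : 0 ≤ (ρ : ℝ) * L * A := by positivity
    calc 16 * K * ‖Φ 0‖ ^ 2 ≤ 16 * K * A := by gcongr
      _ = 16 * √(48 * κ.toReal) * (ρ * L * A) := by rw [hK]; ring
      _ ≤ _ := by linarith)
  have hfx : sobSq s (fun k => ‖unweight s x k‖ₑ) ≠ ⊤ := by rw [sobSq_unweight]; finiteness
  refine ⟨unweight s x, hfx, hsum hfx, fun k => ?_⟩
  conv_lhs => rw [← hx, hΦ]

/-! ### The Banach algebra of bounded holomorphic functions -/

/-- Extension by zero of a function on a subset of `ℂ`. -/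
noncomputable def zeroExt {Ω : Set ℂ} (f : Ω → ℂ) : ℂ → ℂ := Function.extend Subtype.val f 0

theorem zeroExt_apply {Ω : Set ℂ} (f : Ω → ℂ) (z : Ω) : zeroExt f z = f z :=
  Subtype.val_injective.extend_apply f 0 z

theorem differentiableOn_zeroExt_iff {Ω : Set ℂ} {f : Ω → ℂ} {F : ℂ → ℂ} (h : ∀ z : Ω, F z = f z) :
    DifferentiableOn ℂ (zeroExt f) Ω ↔ DifferentiableOn ℂ F Ω :=
  differentiableOn_congr fun z hz => (zeroExt_apply f ⟨z, hz⟩).trans (h ⟨z, hz⟩).symm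

/-- The algebra of bounded holomorphic functions on `Ω`. -/
noncomputable def boundedHol (Ω : Set ℂ) : Subalgebra ℂ (BoundedContinuousFunction Ω ℂ) where
  carrier := {f | DifferentiableOn ℂ (zeroExt f) Ω}
  mul_mem' {f g} hf hg :=
    (differentiableOn_zeroExt_iff fun z => by simp [zeroExt_apply]).2 (hf.mul hg)
  add_mem' {f g} hf hg :=
    (differentiableOn_zeroExt_iff fun z => by simp [zeroExt_apply]).2 (hf.add hg)
  algebraMap_mem' c :=
    (differentiableOn_zeroExt_iff fun z => by simp).2 (differentiableOn_const c)

/-- The Banach algebra of bounded holomorphic functions on `Ω`. -/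
abbrev BHol (Ω : Set ℂ) : Type := boundedHol Ω

namespace BHol

variable {Ω : Set ℂ}

/-- The value at `z`, with value `0` outside of `Ω`. -/
noncomputable def eval (f : BHol Ω) : ℂ → ℂ := zeroExt f.1

theorem eval_coe (f : BHol Ω) (z : Ω) : f.eval z = f.1 z := zeroExt_apply _ z

theorem differentiableOn (f : BHol Ω) : DifferentiableOn ℂ f.eval Ω := f.2

theorem norm_eval_le (f : BHol Ω) {z : ℂ} (hz : z ∈ Ω) : ‖f.eval z‖ ≤ ‖f‖ := by
  rw [eval_coe f ⟨z, hz⟩]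
  exact f.1.norm_coe_le_norm _

theorem norm_le {f : BHol Ω} {C : ℝ} (hC : 0 ≤ C) (h : ∀ z ∈ Ω, ‖f.eval z‖ ≤ C) :
    ‖f‖ ≤ C :=
  (BoundedContinuousFunction.norm_le hC).2 fun z => eval_coe f z ▸ h z z.2

theorem eval_sub (f g : BHol Ω) {z : ℂ} (hz : z ∈ Ω) :
    (f - g).eval z = f.eval z - g.eval z := by
  simp [eval_coe _ ⟨z, hz⟩]

theorem eval_add (f g : BHol Ω) {z : ℂ} (hz : z ∈ Ω) :
    (f + g).eval z = f.eval z + g.eval z := by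
  simp [eval_coe _ ⟨z, hz⟩]

theorem eval_mul (f g : BHol Ω) {z : ℂ} (hz : z ∈ Ω) :
    (f * g).eval z = f.eval z * g.eval z := by
  simp [eval_coe _ ⟨z, hz⟩]

theorem eval_zero : (0 : BHol Ω).eval = 0 := by
  funext z
  by_cases hz : z ∈ Ω
  · simp [eval_coe _ ⟨z, hz⟩]
  · exact Function.extend_apply' _ _ _ (by simpa using hz)

theorem eval_tsum {ι : Type*} {f : ι → BHol Ω} (hf : Summable f) {z : ℂ} (hz : z ∈ Ω) :
    (∑' i, f i).eval z = ∑' i, (f i).eval z := by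
  simp only [eval_coe _ ⟨z, hz⟩]
  exact ContinuousLinearMap.map_tsum
    ((BoundedContinuousFunction.evalCLM ℂ (⟨z, hz⟩ : Ω)).comp
      (Subalgebra.toSubmodule (boundedHol Ω)).subtypeL) hf

/-- A bounded holomorphic function given by a function on `ℂ`. -/
noncomputable def of (F : ℂ → ℂ) (hF : DifferentiableOn ℂ F Ω) (C : ℝ)
    (hC : ∀ z ∈ Ω, ‖F z‖ ≤ C) : BHol Ω :=
  ⟨BoundedContinuousFunction.ofNormedAddCommGroup (fun z : Ω => F z)
    (continuousOn_iff_continuous_domRestrict.1 hF.continuousOn) C fun z => hC z z.2,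
    (differentiableOn_zeroExt_iff fun _ => rfl).2 hF⟩

theorem eval_of {F : ℂ → ℂ} (hF : DifferentiableOn ℂ F Ω) {C : ℝ}
    (hC : ∀ z ∈ Ω, ‖F z‖ ≤ C) {z : ℂ} (hz : z ∈ Ω) : (of F hF C hC).eval z = F z :=
  eval_coe _ ⟨z, hz⟩

theorem isClosed (hΩ : IsOpen Ω) :
    IsClosed (boundedHol Ω : Set (BoundedContinuousFunction Ω ℂ)) := by
  refine isClosed_of_closure_subset fun f hf => ?_
  obtain ⟨g, hg, hgf⟩ := mem_closure_iff_seq_limit.1 hf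
  rw [BoundedContinuousFunction.tendsto_iff_tendstoUniformly] at hgf
  refine TendstoLocallyUniformlyOn.differentiableOn
    (F := fun n => zeroExt (g n)) (φ := Filter.atTop) ?_ (.of_forall hg) hΩ
  refine TendstoUniformlyOn.tendstoLocallyUniformlyOn fun u hu => ?_
  filter_upwards [hgf u hu] with n hn z hz
  simpa [zeroExt_apply _ (⟨z, hz⟩ : Ω)] using hn ⟨z, hz⟩

theorem completeSpace (hΩ : IsOpen Ω) : CompleteSpace (BHol Ω) :=
  (isClosed hΩ).completeSpace_coe

theorem hasDerivAt (hΩ : IsOpen Ω) (f : BHol Ω) {z : ℂ} (hz : z ∈ Ω) :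
    HasDerivAt f.eval (deriv f.eval z) z :=
  ((f.differentiableOn z hz).differentiableAt (hΩ.mem_nhds hz)).hasDerivAt

/-- Bounded holomorphic functions vanishing at `0` are controlled by their derivatives. -/
theorem norm_le_of_hasDerivAt (hΩc : Convex ℝ Ω) (h0 : (0 : ℂ) ∈ Ω) {r : ℝ}
    (hr : ∀ z ∈ Ω, ‖z‖ ≤ r) {g : BHol Ω} (hg0 : g.eval 0 = 0) {g' : ℂ → ℂ}
    (hg : ∀ z ∈ Ω, HasDerivAt g.eval (g' z) z) {C : ℝ} (hC : ∀ z ∈ Ω, ‖g' z‖ ≤ C) :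
    ‖g‖ ≤ r * C := by
  have hC0 : 0 ≤ C := (norm_nonneg _).trans (hC 0 h0)
  have hr0 : 0 ≤ r := (norm_nonneg _).trans (hr 0 h0)
  refine norm_le (by positivity) fun z hz => ?_
  have := hΩc.norm_image_sub_le_of_norm_hasDerivWithin_le
    (fun z hz => (hg z hz).hasDerivWithinAt) hC h0 hz
  rw [hg0, sub_zero, sub_zero] at this
  calc ‖g.eval z‖ ≤ C * ‖z‖ := this
    _ ≤ C * r := by gcongr; exact hr z hz
    _ = r * C := mul_comm _ _

theorem exists_primitive (hΩ : IsOpen Ω) (hΩc : Convex ℝ Ω) (h0 : (0 : ℂ) ∈ Ω) {r : ℝ}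
    (hr : ∀ z ∈ Ω, ‖z‖ ≤ r) (f : BHol Ω) :
    ∃ g : BHol Ω, g.eval 0 = 0 ∧
      ∀ z ∈ Ω, HasDerivAt g.eval (-Complex.I * f.eval z) z := by
  obtain ⟨G, hG⟩ := hΩc.exists_forall_hasDerivWithinAt
    (f.differentiableOn.const_mul (-Complex.I))
  have hG' (z) (hz : z ∈ Ω) : HasDerivAt (fun z => G z - G 0) (-Complex.I * f.eval z) z :=
    ((hG z hz).hasDerivAt (hΩ.mem_nhds hz)).sub_const _
  have hb : ∀ z ∈ Ω, ‖G z - G 0‖ ≤ ‖f‖ * r := fun z hz => by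
    have hn : ∀ z ∈ Ω, ‖-Complex.I * f.eval z‖ ≤ ‖f‖ := fun z hz => by
      rw [norm_mul, norm_neg, Complex.norm_I, one_mul]
      exact f.norm_eval_le hz
    refine (hΩc.norm_image_sub_le_of_norm_hasDerivWithin_le hG hn h0 hz).trans ?_
    rw [sub_zero]
    gcongr
    exact hr z hz
  have hd : DifferentiableOn ℂ (fun z => G z - G 0) Ω :=
    fun z hz => (hG' z hz).differentiableAt.differentiableWithinAt
  refine ⟨of _ hd _ hb, by rw [eval_of hd hb h0, sub_self], fun z hz => ?_⟩
  refine (hG' z hz).congr_of_eventuallyEq ?_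
  filter_upwards [hΩ.mem_nhds hz] with w hw using eval_of hd hb hw

/-- The Schwarz reflection `z ↦ conj (f (conj z))`. -/
theorem exists_reflection (hΩ : IsOpen Ω) (hconj : ∀ z ∈ Ω, conj z ∈ Ω) (f : BHol Ω) :
    ∃ g : BHol Ω, ∀ z ∈ Ω, g.eval z = conj (f.eval (conj z)) := by
  have hd : DifferentiableOn ℂ (conj ∘ f.eval ∘ conj) Ω := fun z hz => by
    have h := (f.hasDerivAt hΩ (hconj z hz)).differentiableAt.conj_conj
    rw [Complex.conj_conj] at h
    exact h.differentiableWithinAt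
  have hb : ∀ z ∈ Ω, ‖(conj ∘ f.eval ∘ conj) z‖ ≤ ‖f‖ := fun z hz => by
    rw [Function.comp_apply, Function.comp_apply, RCLike.norm_conj]
    exact f.norm_eval_le (hconj z hz)
  exact ⟨of _ hd _ hb, fun z hz => eval_of hd hb hz⟩

end BHol

/-! ### `h^s` in terms of extended nonnegative sums -/

theorem sobSq_enorm (s : ℝ) (x : ℤ × ℤ → ℂ) :
    sobSq s (fun k => ‖x k‖ₑ) = ∑' k, ENNReal.ofReal (‖x k‖ ^ 2 * hsWeight s k) := by
  refine tsum_congr fun k => ?_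
  rw [mul_pow, sobW_sq, ENNReal.ofReal_mul (by positivity), ENNReal.ofReal_pow (norm_nonneg _),
    ofReal_norm, mul_comm]

theorem norm_sq_mul_hsWeight_nonneg (s : ℝ) (x : ℤ × ℤ → ℂ) (k : ℤ × ℤ) :
    0 ≤ ‖x k‖ ^ 2 * hsWeight s k :=
  mul_nonneg (by positivity) (hsWeight_pos s k).le

theorem inHs_iff {s : ℝ} {x : ℤ × ℤ → ℂ} : InHs s x ↔ sobSq s (fun k => ‖x k‖ₑ) ≠ ⊤ := by
  rw [sobSq_enorm, InHs]
  refine ⟨fun h => h.tsum_ofReal_ne_top, fun h => ?_⟩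
  refine (ENNReal.summable_toReal h).congr fun k => ?_
  exact ENNReal.toReal_ofReal (norm_sq_mul_hsWeight_nonneg s x k)

theorem sobSq_enorm_eq {s : ℝ} {x : ℤ × ℤ → ℂ} (hx : InHs s x) :
    sobSq s (fun k => ‖x k‖ₑ) = ENNReal.ofReal (hsNorm s x ^ 2) := by
  rw [sobSq_enorm, hsNorm, Real.sq_sqrt (tsum_nonneg (norm_sq_mul_hsWeight_nonneg s x)),
    ENNReal.ofReal_tsum_of_nonneg (norm_sq_mul_hsWeight_nonneg s x) hx]

/-! ### Holomorphic solutions -/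

/-- The time domain of the holomorphic solution. -/
def timeStrip (T : ℝ) : Set ℂ := {z | |z.re| < 2 * T ∧ |z.im| < min 1 T}

theorem isOpen_timeStrip (T : ℝ) : IsOpen (timeStrip T) :=
  (isOpen_lt (Complex.continuous_re.abs) continuous_const).inter
    (isOpen_lt (Complex.continuous_im.abs) continuous_const)

theorem convex_timeStrip (T : ℝ) : Convex ℝ (timeStrip T) := by
  have h1 : Convex ℝ (Complex.reLm ⁻¹' Set.Ioo (-(2 * T)) (2 * T)) :=
    (convex_Ioo _ _).linear_preimage _
  have h2 : Convex ℝ (Complex.imLm ⁻¹' Set.Ioo (-(min 1 T)) (min 1 T)) :=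
    (convex_Ioo _ _).linear_preimage _
  convert h1.inter h2 using 1
  ext z
  simp only [timeStrip, abs_lt]
  rfl

theorem conj_mem_timeStrip {T : ℝ} : ∀ z ∈ timeStrip T, conj z ∈ timeStrip T := by
  simp [timeStrip]

theorem norm_le_of_mem_timeStrip {T : ℝ} : ∀ z ∈ timeStrip T, ‖z‖ ≤ 3 * T := fun z hz => by
  have := Complex.norm_le_abs_re_add_abs_im z
  have := min_le_right 1 T
  linarith [hz.1, hz.2]

theorem mem_timeStrip_of_norm_sub_lt {T t : ℝ} (ht : t ∈ Set.Icc 0 T) {z : ℂ}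
    (hz : ‖z - t‖ < min 1 T) : z ∈ timeStrip T := by
  have h1 := (Complex.abs_re_le_norm _).trans_lt hz
  have h2 := (Complex.abs_im_le_norm _).trans_lt hz
  have := min_le_right 1 T
  simp only [Complex.sub_re, Complex.sub_im, Complex.ofReal_re, Complex.ofReal_im, sub_zero] at h1 h2
  refine ⟨?_, h2⟩
  rw [abs_lt] at h1 ⊢
  constructor <;> linarith [ht.1, ht.2, h1.1, h1.2]

theorem ofReal_mem_timeStrip {T t : ℝ} (hT : 0 < T) (ht : t ∈ Set.Icc 0 T) :
    (t : ℂ) ∈ timeStrip T :=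
  mem_timeStrip_of_norm_sub_lt ht (by simpa using hT)

/-- The terms of the nonlinearity, indexed by all triples. -/
noncomputable def nonlinTerm (ω : ℝ × ℝ) (N : ℕ) (k : ℤ × ℤ) (x : ℤ × ℤ → ℂ) (t : ℝ) :
    Triple → ℂ :=
  (RNset ω N k ∪ WNset ω N k).indicator fun p => monom x p * oscFactor ω k p t

theorem enorm_mul_mul_sub_le {B : Type*} [NormedRing B] (E a b c a' b' c' : B) :
    ‖E * (a * b * c) - E * (a' * b' * c')‖ₑ ≤ ‖E‖ₑ *
      (‖a - a'‖ₑ * ‖b‖ₑ * ‖c‖ₑ + ‖a'‖ₑ * ‖b - b'‖ₑ * ‖c‖ₑ + ‖a'‖ₑ * ‖b'‖ₑ * ‖c - c'‖ₑ) := by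
  have hm (x y : B) : ‖x * y‖ₑ ≤ ‖x‖ₑ * ‖y‖ₑ := by
    rw [enorm_eq_nnnorm, enorm_eq_nnnorm, enorm_eq_nnnorm, ← ENNReal.coe_mul, ENNReal.coe_le_coe]
    exact nnnorm_mul_le x y
  have hm3 (x y z : B) : ‖x * y * z‖ₑ ≤ ‖x‖ₑ * ‖y‖ₑ * ‖z‖ₑ :=
    (hm _ _).trans (mul_le_mul' (hm _ _) le_rfl)
  have : E * (a * b * c) - E * (a' * b' * c') =
      E * ((a - a') * b * c + a' * (b - b') * c + a' * b' * (c - c')) := by noncomm_ring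
  rw [this]
  refine (hm _ _).trans (mul_le_mul' le_rfl ((enorm_add_le _ _).trans (add_le_add
    ((enorm_add_le _ _).trans (add_le_add (hm3 _ _ _) (hm3 _ _ _))) (hm3 _ _ _))))

theorem exists_boundedHol_oscFactor (ω : ℝ × ℝ) (N : ℕ) (T : ℝ) (k : ℤ × ℤ) (p : Triple) :
    ∃ E : BHol (timeStrip T), ‖E‖ ≤ Real.exp 1 ∧
      (p ∉ RNset ω N k ∪ WNset ω N k → E = 0) ∧
      (p ∈ RNset ω N k ∪ WNset ω N k → ∀ t : ℝ, (t : ℂ) ∈ timeStrip T →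
        E.eval t = oscFactor ω k p t) := by
  by_cases hp : p ∈ RNset ω N k ∪ WNset ω N k
  swap
  · exact ⟨0, by simpa using (Real.exp_pos 1).le, fun _ => rfl, fun h => absurd h hp⟩
  set μ : ℝ := freq ω p.1 + freq ω p.2.1 - freq ω p.2.2 - freq ω k with hμ
  have hμ1 : |μ| ≤ 1 := by
    rcases hp with hp | hp
    · have : μ = 0 := by rw [hμ, hp.2.1]; ring
      simp [this]
    · exact hp.2.1
  have hd : DifferentiableOn ℂ (fun z => Complex.exp (Complex.I * (μ : ℂ) * z)) (timeStrip T) := by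
    fun_prop
  have hb : ∀ z ∈ timeStrip T, ‖Complex.exp (Complex.I * (μ : ℂ) * z)‖ ≤ Real.exp 1 := by
    intro z hz
    rw [Complex.norm_exp, Real.exp_le_exp]
    have h1 : (Complex.I * (μ : ℂ) * z).re = -(μ * z.im) := by simp
    have h2 : |z.im| ≤ 1 := (hz.2.trans_le (min_le_left _ _)).le
    rw [h1]
    calc -(μ * z.im) ≤ |μ * z.im| := neg_le_abs _
      _ = |μ| * |z.im| := abs_mul _ _
      _ ≤ 1 * 1 := by gcongr
      _ = 1 := one_mul 1
  refine ⟨BHol.of _ hd _ hb, ?_, fun h => absurd hp h, fun _ t ht => BHol.eval_of hd hb ht⟩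
  refine BHol.norm_le (Real.exp_pos 1).le fun z hz => ?_
  rw [BHol.eval_of hd hb hz]
  exact hb z hz

theorem exists_holomorphic_solution {s : ℝ} (hs : 1 < s) :
    ∃ c > (0 : ℝ), ∀ (ω : ℝ × ℝ) (N : ℕ) (u0 : ℤ × ℤ → ℂ), InHs s u0 →
      ∀ T > (0 : ℝ), T * hsNorm s u0 ^ 2 ≤ c →
      ∃ U : ℤ × ℤ → BHol (timeStrip T), sobSq s (fun k => ‖U k‖ₑ) ≠ ⊤ ∧
        (∀ k, (U k).eval 0 = u0 k) ∧
        ∀ k, ∀ t : ℝ, (t : ℂ) ∈ timeStrip T → HasDerivAt (U k).eval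
          (-Complex.I * ∑' p, nonlinTerm ω N k (fun j => (U j).eval t) t p) t := by
  obtain ⟨κ, hκ, hsol⟩ := exists_solution_of_cubic hs
  refine ⟨(3 * κ * Real.exp 1)⁻¹, by positivity, fun ω N u0 hu0 T hT hTc => ?_⟩
  set Ω := timeStrip T with hΩ
  have hΩo : IsOpen Ω := isOpen_timeStrip T
  have hΩc : Convex ℝ Ω := convex_timeStrip T
  have h0 : (0 : ℂ) ∈ Ω := mod_cast ofReal_mem_timeStrip hT ⟨le_rfl, hT.le⟩
  have hr : ∀ z ∈ Ω, ‖z‖ ≤ 3 * T := norm_le_of_mem_timeStrip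
  have : CompleteSpace (BHol Ω) := BHol.completeSpace hΩo
  choose I hI0 hI using BHol.exists_primitive (Ω := Ω) hΩo hΩc h0 hr
  choose J hJ using BHol.exists_reflection (Ω := Ω) hΩo conj_mem_timeStrip
  choose E hE hE0 hEt using exists_boundedHol_oscFactor ω N T
  have hIlip (f g : BHol Ω) : ‖I f - I g‖ ≤ 3 * T * ‖f - g‖ := by
    refine BHol.norm_le_of_hasDerivAt hΩc h0 hr (g' := fun z => -Complex.I * (f - g).eval z)
      ?_ (fun z hz => ?_) fun z hz => ?_
    · rw [BHol.eval_sub _ _ h0, hI0, hI0, sub_zero]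
    · rw [BHol.eval_sub _ _ hz, mul_sub]
      refine ((hI f z hz).sub (hI g z hz)).congr_of_eventuallyEq ?_
      filter_upwards [hΩo.mem_nhds hz] with w hw using BHol.eval_sub _ _ hw
    · rw [norm_mul, norm_neg, Complex.norm_I, one_mul]
      exact (f - g).norm_eval_le hz
  have hIz : I 0 = 0 := by
    have : ‖I 0‖ ≤ 3 * T * 0 := by
      refine BHol.norm_le_of_hasDerivAt hΩc h0 hr (hI0 0) (hI 0) fun z hz => ?_
      rw [BHol.eval_zero, Pi.zero_apply, mul_zero, norm_zero]
    rw [mul_zero] at this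
    exact norm_le_zero_iff.1 this
  have hJsub (f g : BHol Ω) : ‖J f - J g‖ ≤ ‖f - g‖ := by
    refine BHol.norm_le (norm_nonneg _) fun z hz => ?_
    rw [BHol.eval_sub _ _ hz, hJ f z hz, hJ g z hz, ← map_sub, RCLike.norm_conj,
      ← BHol.eval_sub _ _ (conj_mem_timeStrip z hz)]
    exact (f - g).norm_eval_le (conj_mem_timeStrip z hz)
  have hJn (f : BHol Ω) : ‖J f‖ ≤ ‖f‖ := by
    refine BHol.norm_le (norm_nonneg _) fun z hz => ?_
    rw [hJ f z hz, RCLike.norm_conj]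
    exact f.norm_eval_le (conj_mem_timeStrip z hz)
  have hcb (k : ℤ × ℤ) : ∀ z ∈ Ω, ‖(fun _ : ℂ => u0 k) z‖ ≤ ‖u0 k‖ := fun _ _ => le_rfl
  have hcd (k : ℤ × ℤ) : DifferentiableOn ℂ (fun _ : ℂ => u0 k) Ω := differentiableOn_const _
  obtain ⟨U, hU, hUs, hUe⟩ := hsol (B := BHol Ω) I (3 * T).toNNReal hIz
    (LipschitzWith.of_dist_le_mul fun f g => by
      rw [dist_eq_norm, dist_eq_norm, Real.coe_toNNReal _ (by positivity)]
      exact hIlip f g)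
    (fun k p a b c => E k p * (a * b * J c)) (Real.exp 1).toNNReal
    (fun k p => by rw [mul_zero, zero_mul, mul_zero])
    (fun k p a b c hp => by
      rw [hE0 k p, zero_mul]
      rintro (h | h)
      exacts [hp h.1, hp h.1])
    (fun k p a b c a' b' c' => by
      refine (enorm_mul_mul_sub_le _ _ _ _ _ _ _).trans ?_
      have hEe : ‖E k p‖ₑ ≤ ENNReal.ofReal (Real.exp 1) := by
        rw [← ofReal_norm]; exact ENNReal.ofReal_le_ofReal (hE k p)
      gcongr
      exacts [hEe, enorm_le_iff_norm_le.2 (hJn _), enorm_le_iff_norm_le.2 (hJn _),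
        enorm_le_iff_norm_le.2 (hJsub _ _)])
    (fun k => BHol.of _ (hcd k) _ (hcb k)) (hsNorm s u0 ^ 2) (by positivity)
    (by
      rw [← sobSq_enorm_eq hu0]
      refine sobSq_mono fun k => ?_
      rw [enorm_le_iff_norm_le]
      refine BHol.norm_le (norm_nonneg _) fun z hz => ?_
      rw [BHol.eval_of (hcd k) (hcb k) hz])
    (by
      rw [Real.coe_toNNReal _ (by positivity), Real.coe_toNNReal _ (by positivity)]
      calc κ * (3 * T * Real.exp 1 * hsNorm s u0 ^ 2)
          = 3 * κ * Real.exp 1 * (T * hsNorm s u0 ^ 2) := by ring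
        _ ≤ 3 * κ * Real.exp 1 * (3 * κ * Real.exp 1)⁻¹ := by gcongr
        _ = 1 := mul_inv_cancel₀ (by positivity))
  refine ⟨U, hU, fun k => ?_, fun k t ht => ?_⟩
  · rw [hUe k, BHol.eval_add _ _ h0, hI0, add_zero, BHol.eval_of (hcd k) (hcb k) h0]
  · have h1 : (∑' p : Triple, E k p * (U p.1 * U p.2.1 * J (U p.2.2))).eval t =
        ∑' p, nonlinTerm ω N k (fun j => (U j).eval t) t p := by
      rw [BHol.eval_tsum (hUs k) ht]
      refine tsum_congr fun p => ?_
      by_cases hp : p ∈ RNset ω N k ∪ WNset ω N k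
      · rw [nonlinTerm, Set.indicator_of_mem hp, BHol.eval_mul _ _ ht, BHol.eval_mul _ _ ht,
          BHol.eval_mul _ _ ht, hJ _ _ ht, hEt k p hp t ht, Complex.conj_ofReal, monom, mul_comm]
      · rw [nonlinTerm, Set.indicator_of_notMem hp, hE0 k p hp, zero_mul, BHol.eval_zero,
          Pi.zero_apply]
    rw [← h1]
    refine ((hI _ t ht).const_add (u0 k)).congr_of_eventuallyEq ?_
    filter_upwards [hΩo.mem_nhds ht] with w hw
    rw [hUe k, BHol.eval_add _ _ hw, BHol.eval_of (hcd k) (hcb k) hw]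

/-! ### The nonlinearity as a sum over all triples -/

theorem norm_oscFactor (ω : ℝ × ℝ) (k : ℤ × ℤ) (p : Triple) (t : ℝ) :
    ‖oscFactor ω k p t‖ = 1 := by
  rw [oscFactor, Complex.norm_exp]
  simp

theorem add_eq_add_of_mem {ω : ℝ × ℝ} {N : ℕ} {k : ℤ × ℤ} {p : Triple}
    (hp : p ∈ RNset ω N k ∪ WNset ω N k) : p.1 + p.2.1 = p.2.2 + k := by
  rcases hp with hp | hp <;> exact hp.1

theorem disjoint_RNset_WNset (ω : ℝ × ℝ) (N : ℕ) (k : ℤ × ℤ) :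
    Disjoint (RNset ω N k) (WNset ω N k) := by
  refine Set.disjoint_left.2 fun p hR hW => ?_
  rcases hW.2.2 with h | h
  · exact h.not_ge hR.2.2.1
  · exact h.not_ge hR.2.2.2.2.1

theorem oscFactor_of_mem_RNset {ω : ℝ × ℝ} {N : ℕ} {k : ℤ × ℤ} {p : Triple}
    (hp : p ∈ RNset ω N k) (t : ℝ) : oscFactor ω k p t = 1 := by
  have : freq ω p.1 + freq ω p.2.1 - freq ω p.2.2 - freq ω k = 0 := by rw [hp.2.1]; ring
  rw [oscFactor, this]
  simp

theorem enorm_nonlinTerm_sub_le (ω : ℝ × ℝ) (N : ℕ) (k : ℤ × ℤ) (x y : ℤ × ℤ → ℂ) (t : ℝ)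
    (p : Triple) : ‖nonlinTerm ω N k x t p - nonlinTerm ω N k y t p‖ₑ ≤
      if p.1 + p.2.1 = p.2.2 + k then
        ‖x p.1 - y p.1‖ₑ * ‖x p.2.1‖ₑ * ‖x p.2.2‖ₑ + ‖y p.1‖ₑ * ‖x p.2.1 - y p.2.1‖ₑ * ‖x p.2.2‖ₑ +
          ‖y p.1‖ₑ * ‖y p.2.1‖ₑ * ‖x p.2.2 - y p.2.2‖ₑ else 0 := by
  by_cases hp : p ∈ RNset ω N k ∪ WNset ω N k
  · rw [if_pos (add_eq_add_of_mem hp), nonlinTerm, nonlinTerm, Set.indicator_of_mem hp,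
      Set.indicator_of_mem hp, mul_comm (monom x p), mul_comm (monom y p), monom, monom]
    refine (enorm_mul_mul_sub_le _ _ _ _ _ _ _).trans_eq ?_
    have hc (z : ℂ) : ‖conj z‖ₑ = ‖z‖ₑ := by rw [← ofReal_norm, RCLike.norm_conj, ofReal_norm]
    rw [← map_sub, hc, hc, ← ofReal_norm (oscFactor ω k p t), norm_oscFactor, ENNReal.ofReal_one,
      one_mul]
  · rw [nonlinTerm, nonlinTerm, Set.indicator_of_notMem hp, Set.indicator_of_notMem hp, sub_zero,
      enorm_zero]
    exact zero_le

theorem nonlinTerm_zero (ω : ℝ × ℝ) (N : ℕ) (k : ℤ × ℤ) (t : ℝ) (p : Triple) :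
    nonlinTerm ω N k 0 t p = 0 := by
  simp [nonlinTerm, monom, Set.indicator]

theorem summable_nonlinTerm (ω : ℝ × ℝ) (N : ℕ) (k : ℤ × ℤ) {x : ℤ × ℤ → ℂ}
    (hx : ∑' k, ‖x k‖ₑ ≠ ⊤) (t : ℝ) : Summable (nonlinTerm ω N k x t) := by
  refine Summable.of_norm (tsum_enorm_ne_top_iff_summable_norm.1 ?_)
  have hle : ∑' p, ‖nonlinTerm ω N k x t p‖ₑ ≤
      triConv (fun k => ‖x k‖ₑ) (fun k => ‖x k‖ₑ) (fun k => ‖x k‖ₑ) k :=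
    ENNReal.tsum_le_tsum fun p => by
      simpa [nonlinTerm_zero] using enorm_nonlinTerm_sub_le ω N k x 0 t p
  refine ne_top_of_le_ne_top ?_ (hle.trans (triConv_le _ _ _ k))
  finiteness

theorem summable_norm_monom {ω : ℝ × ℝ} {N : ℕ} {k : ℤ × ℤ} {x : ℤ × ℤ → ℂ}
    (hx : ∑' k, ‖x k‖ₑ ≠ ⊤) {S : Set Triple} (hS : S ⊆ RNset ω N k ∪ WNset ω N k) :
    Summable fun p : S => ‖monom x p.1‖ := by
  refine ((summable_nonlinTerm ω N k hx 0).norm.comp_injective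
    (Subtype.val_injective (p := (· ∈ S)))).congr fun p => ?_
  rw [Function.comp_apply, nonlinTerm, Set.indicator_of_mem (hS p.2), norm_mul, norm_oscFactor,
    mul_one]

theorem tsum_nonlinTerm (ω : ℝ × ℝ) (N : ℕ) (k : ℤ × ℤ) {x : ℤ × ℤ → ℂ}
    (hx : ∑' k, ‖x k‖ₑ ≠ ⊤) (t : ℝ) :
    ∑' p, nonlinTerm ω N k x t p = (∑' p : RNset ω N k, monom x p.1) +
      ∑' p : WNset ω N k, monom x p.1 * oscFactor ω k p.1 t := by
  have hW : Summable fun p : WNset ω N k => monom x p.1 * oscFactor ω k p.1 t :=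
    Summable.of_norm (by
      simpa [norm_oscFactor] using summable_norm_monom hx Set.subset_union_right)
  have hR : Summable fun p : RNset ω N k => monom x p.1 * oscFactor ω k p.1 t :=
    Summable.of_norm (by
      simpa [norm_oscFactor] using summable_norm_monom hx Set.subset_union_left)
  unfold nonlinTerm
  rw [← tsum_subtype, Summable.tsum_union_disjoint (f := fun p => monom x p * oscFactor ω k p t)
    (disjoint_RNset_WNset ω N k) hR hW]
  congr 1
  refine tsum_congr fun p => ?_
  rw [oscFactor_of_mem_RNset p.2, mul_one]

theorem tsum_enorm_nonlin_sub_le (ω : ℝ × ℝ) (N : ℕ) {x y : ℤ × ℤ → ℂ} {M : ℝ≥0}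
    (hx : ∑' k, ‖x k‖ₑ ≤ M) (hy : ∑' k, ‖y k‖ₑ ≤ M) (t : ℝ) :
    ∑' k, ‖∑' p, nonlinTerm ω N k x t p - ∑' p, nonlinTerm ω N k y t p‖ₑ ≤
      (3 * M ^ 2 : ℝ≥0) * ∑' k, ‖x k - y k‖ₑ := by
  have hx' := ne_top_of_le_ne_top ENNReal.coe_ne_top hx
  have hy' := ne_top_of_le_ne_top ENNReal.coe_ne_top hy
  set X : ℤ × ℤ → ℝ≥0∞ := fun k => ‖x k‖ₑ
  set Y : ℤ × ℤ → ℝ≥0∞ := fun k => ‖y k‖ₑ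
  set D : ℤ × ℤ → ℝ≥0∞ := fun k => ‖x k - y k‖ₑ
  have hk (k) : ‖∑' p, nonlinTerm ω N k x t p - ∑' p, nonlinTerm ω N k y t p‖ₑ ≤
      triConv D X X k + triConv Y D X k + triConv Y Y D k := by
    rw [← (summable_nonlinTerm ω N k hx' t).tsum_sub (summable_nonlinTerm ω N k hy' t)]
    refine enorm_tsum_le_tsum_enorm.trans ?_
    unfold triConv
    rw [← ENNReal.tsum_add, ← ENNReal.tsum_add]
    refine ENNReal.tsum_le_tsum fun p => ?_
    refine (enorm_nonlinTerm_sub_le ω N k x y t p).trans_eq ?_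
    split_ifs <;> simp [X, Y, D]
  refine (ENNReal.tsum_le_tsum hk).trans ?_
  rw [ENNReal.tsum_add, ENNReal.tsum_add, tsum_triConv, tsum_triConv, tsum_triConv]
  calc (∑' k, D k) * (∑' k, X k) * (∑' k, X k) + (∑' k, Y k) * (∑' k, D k) * (∑' k, X k) +
        (∑' k, Y k) * (∑' k, Y k) * ∑' k, D k
      ≤ (∑' k, D k) * M * M + M * (∑' k, D k) * M + M * M * ∑' k, D k := by gcongr
    _ = _ := by push_cast; ring

/-! ### Uniqueness -/

/-- Grönwall's lemma in `ℓ¹`. -/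
theorem eq_zero_of_tsum_enorm_deriv_le {ι : Type*} {T : ℝ} {d d' : ι → ℝ → ℂ}
    (hd : ∀ k, ∀ t ∈ Set.Icc 0 T, HasDerivWithinAt (d k) (d' k t) (Set.Icc 0 T) t)
    (h0 : ∀ k, d k 0 = 0) {K : ℝ≥0}
    (hK : ∀ t ∈ Set.Icc 0 T, ∑' k, ‖d' k t‖ₑ ≤ K * ∑' k, ‖d k t‖ₑ) {S : ℝ} (hS0 : 0 ≤ S)
    (hS : ∀ t ∈ Set.Icc 0 T, ∑' k, ‖d k t‖ₑ ≤ ENNReal.ofReal S) :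
    ∀ t ∈ Set.Icc 0 T, ∀ k, d k t = 0 := by
  have step {S : ℝ} (hS0 : 0 ≤ S)
      (hS : ∀ t ∈ Set.Icc 0 T, ∑' k, ‖d k t‖ₑ ≤ ENNReal.ofReal (S * Real.exp (2 * K * t))) :
      ∀ t ∈ Set.Icc 0 T, ∑' k, ‖d k t‖ₑ ≤ ENNReal.ofReal (S / 2 * Real.exp (2 * K * t)) := by
    intro t₀ ht₀
    refine ENNReal.summable.tsum_le_of_sum_le fun A => ?_
    have hθ (k) : ∃ θ : ℂ, ‖θ‖ = 1 ∧ θ * d k t₀ = ‖d k t₀‖ := by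
      by_cases h : d k t₀ = 0
      · exact ⟨1, by simp, by simp [h]⟩
      · have hn : (‖d k t₀‖ : ℂ) ≠ 0 := by simpa using h
        refine ⟨conj (d k t₀) / ‖d k t₀‖, by simp [h], ?_⟩
        rw [div_mul_eq_mul_div, Complex.conj_mul', sq, mul_div_assoc, div_self hn, mul_one]
    choose θ hθ1 hθ using hθ
    have hder (t) (ht : t ∈ Set.Icc 0 T) : HasDerivWithinAt (fun t => ∑ k ∈ A, θ k * d k t)
        (∑ k ∈ A, θ k * d' k t) (Set.Icc 0 T) t :=
      HasDerivWithinAt.fun_sum fun k _ => (hd k t ht).const_mul _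
    have hBder (t : ℝ) : HasDerivAt (fun t => S / 2 * Real.exp (2 * K * t))
        (K * (S * Real.exp (2 * K * t))) t := by
      have := (((hasDerivAt_id t).const_mul (2 * (K : ℝ))).exp).const_mul (S / 2)
      refine this.congr_deriv ?_
      simp only [id_eq]
      ring
    have hmain := image_norm_le_of_norm_deriv_right_le_deriv_boundary'
      (fun t ht => (hder t ht).continuousWithinAt)
      (fun t ht => (hder t (Set.Ico_subset_Icc_self ht)).mono_of_mem_nhdsWithin
        (Icc_mem_nhdsGE_of_mem ht))
      (by simp only [h0, mul_zero, Finset.sum_const_zero, norm_zero]; positivity)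
      (fun t _ => (hBder t).continuousAt.continuousWithinAt)
      (fun t _ => (hBder t).hasDerivWithinAt)
      (fun t ht => by
        have ht' := Set.Ico_subset_Icc_self ht
        rw [← ENNReal.ofReal_le_ofReal_iff (by positivity), ofReal_norm]
        calc ‖∑ k ∈ A, θ k * d' k t‖ₑ ≤ ∑ k ∈ A, ‖θ k * d' k t‖ₑ := enorm_sum_le _ _
          _ = ∑ k ∈ A, ‖d' k t‖ₑ := by
            refine Finset.sum_congr rfl fun k _ => ?_
            rw [← ofReal_norm, norm_mul, hθ1, one_mul, ofReal_norm]
          _ ≤ ∑' k, ‖d' k t‖ₑ := ENNReal.sum_le_tsum A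
          _ ≤ K * ENNReal.ofReal (S * Real.exp (2 * K * t)) :=
            (hK t ht').trans (mul_le_mul' le_rfl (hS t ht'))
          _ = ENNReal.ofReal (K * (S * Real.exp (2 * K * t))) := by
            rw [ENNReal.ofReal_mul K.coe_nonneg, ENNReal.ofReal_coe_nnreal])
      ht₀
    have hsum : ∑ k ∈ A, θ k * d k t₀ = ((∑ k ∈ A, ‖d k t₀‖ : ℝ) : ℂ) := by
      push_cast
      exact Finset.sum_congr rfl fun k _ => hθ k
    rw [hsum, Complex.norm_real, Real.norm_of_nonneg (by positivity)] at hmain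
    refine le_trans (le_of_eq ?_) (ENNReal.ofReal_le_ofReal hmain)
    rw [ENNReal.ofReal_sum_of_nonneg fun _ _ => norm_nonneg _]
    exact Finset.sum_congr rfl fun k _ => (ofReal_norm _).symm
  have iter (n : ℕ) : ∀ t ∈ Set.Icc 0 T,
      ∑' k, ‖d k t‖ₑ ≤ ENNReal.ofReal (S * (1 / 2) ^ n * Real.exp (2 * K * t)) := by
    induction n with
    | zero =>
      intro t ht
      refine (hS t ht).trans (ENNReal.ofReal_le_ofReal ?_)
      rw [pow_zero, mul_one]
      have := ht.1
      exact le_mul_of_one_le_right hS0 (Real.one_le_exp (by positivity))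
    | succ n ih =>
      intro t ht
      convert step (by positivity) ih t ht using 2
      ring
  intro t ht k
  have hlim : Filter.Tendsto (fun n : ℕ => ENNReal.ofReal (S * (1 / 2) ^ n * Real.exp (2 * K * t)))
      Filter.atTop (nhds (ENNReal.ofReal (S * 0 * Real.exp (2 * K * t)))) :=
    ENNReal.tendsto_ofReal (((tendsto_pow_atTop_nhds_zero_of_lt_one (by norm_num)
      (by norm_num)).const_mul S).mul_const _)
  have h := ge_of_tendsto' hlim fun n => (ENNReal.le_tsum k).trans (iter n t ht)
  simpa using h

theorem exists_tsum_enorm_le_of_hsContOn {s T : ℝ} (hs : 1 < s) {v : ℝ → ℤ × ℤ → ℂ}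
    (hv : ∀ t ∈ Set.Icc (0 : ℝ) T, InHs s (v t)) (hvc : HsContOn s T v) :
    ∃ M : ℝ≥0, ∀ t ∈ Set.Icc (0 : ℝ) T, ∑' k, ‖v t k‖ₑ ≤ M := by
  suffices h : ∃ M : ℝ≥0, ∀ t ∈ Set.Icc (0 : ℝ) T, t ∈ Set.Icc (0 : ℝ) T →
      ∑' k, ‖v t k‖ₑ ≤ M from h.imp fun M hM t ht => hM t ht ht
  refine isCompact_Icc.induction_on (p := fun A => ∃ M : ℝ≥0, ∀ t ∈ A,
    t ∈ Set.Icc (0 : ℝ) T → ∑' k, ‖v t k‖ₑ ≤ M) ⟨0, by simp⟩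
    (fun A B hAB ⟨M, hM⟩ => ⟨M, fun t ht => hM t (hAB ht)⟩)
    (fun A B ⟨M, hM⟩ ⟨M', hM'⟩ => ⟨max M M', fun t ht ht' => ?_⟩) fun t ht => ?_
  · rcases ht with ht | ht
    · exact (hM t ht ht').trans (by simp)
    · exact (hM' t ht ht').trans (by simp)
  obtain ⟨δ, hδ, h⟩ := hvc t ht 1 one_pos
  have hfin : ∑' k, ‖v t k‖ₑ + (1 + embConst s) ≠ ⊤ := by
    have := tsum_ne_top_of_sobSq hs (inHs_iff.1 (hv t ht))
    have := embConst_ne_top hs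
    finiteness
  refine ⟨Metric.ball t δ, mem_nhdsWithin_of_mem_nhds (Metric.ball_mem_nhds t hδ),
    (∑' k, ‖v t k‖ₑ + (1 + embConst s)).toNNReal, fun t' ht' htI => ?_⟩
  rw [ENNReal.coe_toNNReal hfin]
  have hsub : InHs s fun k => v t' k - v t k := by
    refine inHs_iff.2 (ne_top_of_le_ne_top ?_ ((sobSq_mono fun k => enorm_sub_le).trans
      (sobSq_add_le s _ _)))
    have := inHs_iff.1 (hv t ht)
    have := inHs_iff.1 (hv t' htI)
    finiteness
  have h1 : (∑' k, ‖v t' k - v t k‖ₑ) ^ 2 ≤ embConst s := by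
    refine (sq_tsum_le_sobSq s _).trans ?_
    rw [sobSq_enorm_eq hsub]
    refine mul_le_of_le_one_right' (ENNReal.ofReal_le_one.2 ?_)
    exact pow_le_one₀ (Real.sqrt_nonneg _) (h t' htI ht').le
  have h2 : ∑' k, ‖v t' k - v t k‖ₑ ≤ 1 + embConst s := by
    rcases le_total (∑' k, ‖v t' k - v t k‖ₑ) 1 with h | h
    · exact h.trans le_self_add
    · exact ((le_self_pow h two_ne_zero).trans h1).trans le_add_self
  calc ∑' k, ‖v t' k‖ₑ ≤ ∑' k, (‖v t k‖ₑ + ‖v t' k - v t k‖ₑ) := ENNReal.tsum_le_tsum fun k => by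
        simpa using enorm_add_le (v t k) (v t' k - v t k)
    _ ≤ _ := by
      rw [ENNReal.tsum_add]
      gcongr

theorem SolvesTruncated.hasDerivWithinAt {ω : ℝ × ℝ} {N : ℕ} {T : ℝ} {u : ℝ → ℤ × ℤ → ℂ}
    (h : SolvesTruncated ω N T u) {t : ℝ} (ht : t ∈ Set.Icc 0 T) (hu : ∑' k, ‖u t k‖ₑ ≠ ⊤)
    (k : ℤ × ℤ) : HasDerivWithinAt (fun τ => u τ k)
      (-Complex.I * ∑' p, nonlinTerm ω N k (u t) t p) (Set.Icc 0 T) t := by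
  rw [tsum_nonlinTerm ω N k hu]
  exact (h t ht k).2.2

theorem SolvesTruncated.unique {s T : ℝ} (hs : 1 < s) {ω : ℝ × ℝ} {N : ℕ} {u v : ℝ → ℤ × ℤ → ℂ}
    (huv : u 0 = v 0) (hu : ∀ t ∈ Set.Icc (0 : ℝ) T, InHs s (u t)) (huc : HsContOn s T u)
    (hus : SolvesTruncated ω N T u) (hv : ∀ t ∈ Set.Icc (0 : ℝ) T, InHs s (v t))
    (hvc : HsContOn s T v) (hvs : SolvesTruncated ω N T v) :
    ∀ t ∈ Set.Icc (0 : ℝ) T, u t = v t := by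
  obtain ⟨M₁, hM₁⟩ := exists_tsum_enorm_le_of_hsContOn hs hu huc
  obtain ⟨M₂, hM₂⟩ := exists_tsum_enorm_le_of_hsContOn hs hv hvc
  set M := max M₁ M₂
  have hMu (t) (ht : t ∈ Set.Icc 0 T) : ∑' k, ‖u t k‖ₑ ≤ M := (hM₁ t ht).trans (by simp [M])
  have hMv (t) (ht : t ∈ Set.Icc 0 T) : ∑' k, ‖v t k‖ₑ ≤ M := (hM₂ t ht).trans (by simp [M])
  have hfin {x : ℤ × ℤ → ℂ} (h : ∑' k, ‖x k‖ₑ ≤ M) := ne_top_of_le_ne_top ENNReal.coe_ne_top h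
  have key := eq_zero_of_tsum_enorm_deriv_le (d := fun k t => u t k - v t k)
    (fun k t ht => (hus.hasDerivWithinAt ht (hfin (hMu t ht)) k).sub
      (hvs.hasDerivWithinAt ht (hfin (hMv t ht)) k))
    (fun k => by simp [huv]) (K := 3 * M ^ 2) (fun t ht => ?_) (S := 2 * M) (by positivity)
    fun t ht => ?_
  · exact fun t ht => funext fun k => sub_eq_zero.1 (key t ht k)
  · refine le_trans (le_of_eq (tsum_congr fun k => ?_))
      (tsum_enorm_nonlin_sub_le ω N (hMu t ht) (hMv t ht) t)
    rw [← mul_sub, ← ofReal_norm, norm_mul, norm_neg, Complex.norm_I, one_mul, ofReal_norm]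
  · calc ∑' k, ‖u t k - v t k‖ₑ ≤ ∑' k, (‖u t k‖ₑ + ‖v t k‖ₑ) :=
          ENNReal.tsum_le_tsum fun k => enorm_sub_le
      _ ≤ M + M := by
        rw [ENNReal.tsum_add]
        exact add_le_add (hMu t ht) (hMv t ht)
      _ = ENNReal.ofReal (2 * M) := by
        rw [← two_mul, ENNReal.ofReal_mul two_pos.le, ENNReal.ofReal_coe_nnreal,
          ENNReal.ofReal_ofNat]

/-! ### Regularity in time -/

theorem hsContOn_of_continuousOn {s T : ℝ} {u : ℝ → ℤ × ℤ → ℂ} {a : ℤ × ℤ → ℝ}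
    (ha : Summable fun k => a k ^ 2 * hsWeight s k)
    (hua : ∀ t ∈ Set.Icc (0 : ℝ) T, ∀ k, ‖u t k‖ ≤ a k)
    (hu : ∀ k, ContinuousOn (fun t => u t k) (Set.Icc 0 T)) : HsContOn s T u := by
  intro t ht ε hε
  have hlim : Filter.Tendsto (fun t' => ∑' k, ‖u t' k - u t k‖ ^ 2 * hsWeight s k)
      (nhdsWithin t (Set.Icc 0 T)) (nhds (∑' k : ℤ × ℤ, ‖u t k - u t k‖ ^ 2 * hsWeight s k)) := by
    refine tendsto_tsum_of_dominated_convergence (ha.mul_left 4)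
      (fun k => ((((hu k t ht).sub_const _).norm).pow 2).mul_const _) ?_
    filter_upwards [self_mem_nhdsWithin] with t' ht' k
    have hw := hsWeight_pos s k
    rw [Real.norm_of_nonneg (by positivity)]
    have h1 : ‖u t' k - u t k‖ ≤ 2 * a k := by
      linarith [norm_sub_le (u t' k) (u t k), hua t ht k, hua t' ht' k]
    calc ‖u t' k - u t k‖ ^ 2 * hsWeight s k ≤ (2 * a k) ^ 2 * hsWeight s k := by gcongr
      _ = 4 * (a k ^ 2 * hsWeight s k) := by ring
  have hlim' := hlim.sqrt
  simp only [sub_self, norm_zero, ne_eq, OfNat.ofNat_ne_zero, not_false_eq_true, zero_pow,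
    zero_mul, tsum_zero, Real.sqrt_zero] at hlim'
  obtain ⟨δ, hδ, h⟩ := Metric.tendsto_nhdsWithin_nhds.1 hlim' ε hε
  refine ⟨δ, hδ, fun t' ht' htt' => ?_⟩
  have := h ht' htt'
  rw [Real.dist_0_eq_abs] at this
  exact (le_abs_self _).trans_lt this

theorem iteratedDerivWithin_comp_ofReal {F : ℂ → ℂ} {T : ℝ} (hT : 0 < T)
    (hF : ∀ t ∈ Set.Icc 0 T, AnalyticAt ℂ F (t : ℝ)) (n : ℕ) :
    ∀ t ∈ Set.Icc 0 T, iteratedDerivWithin n (fun τ : ℝ => F τ) (Set.Icc 0 T) t =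
      iteratedDeriv n F t := by
  induction n with
  | zero => intro t _; simp
  | succ n ih =>
    intro t ht
    rw [iteratedDerivWithin_succ, derivWithin_congr ih (ih t ht), iteratedDeriv_succ]
    have h : DifferentiableAt ℂ (iteratedDeriv n F) (t : ℂ) := by
      rw [iteratedDeriv_eq_iterate]
      exact ((hF t ht).iterated_deriv n).differentiableAt
    exact h.hasDerivAt.comp_ofReal.hasDerivWithinAt.derivWithin (uniqueDiffOn_Icc hT t ht)

theorem BHol.analyticAt {Ω : Set ℂ} (hΩ : IsOpen Ω) (f : BHol Ω) {z : ℂ} (hz : z ∈ Ω) :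
    AnalyticAt ℂ f.eval z :=
  f.differentiableOn.analyticAt (hΩ.mem_nhds hz)

theorem analyticAt_comp_ofReal {F : ℂ → ℂ} {t : ℝ} (hF : AnalyticAt ℂ F t) :
    AnalyticAt ℝ (fun τ : ℝ => F τ) t :=
  AnalyticAt.fun_comp (g := F) (f := fun τ : ℝ => (τ : ℂ)) hF.restrictScalars
    (Complex.ofRealCLM.analyticAt t)

theorem norm_iteratedDeriv_eval_le {T : ℝ} (hT : 0 < T) (f : BHol (timeStrip T)) (n : ℕ) {t : ℝ}
    (ht : t ∈ Set.Icc 0 T) :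
    ‖iteratedDeriv n f.eval t‖ ≤ n.factorial * ‖f‖ / (min 1 T / 2) ^ n := by
  have hρ : 0 < min 1 T := by positivity
  have hball {z : ℂ} (hz : z ∈ Metric.closedBall (t : ℂ) (min 1 T / 2)) : z ∈ timeStrip T :=
    mem_timeStrip_of_norm_sub_lt ht
      ((mem_closedBall_iff_norm.1 hz).trans_lt (half_lt_self hρ))
  refine Complex.norm_iteratedDeriv_le_of_forall_mem_sphere_norm_le n (half_pos hρ) ?_
    fun z hz => f.norm_eval_le (hball (Metric.sphere_subset_closedBall hz))
  refine DifferentiableOn.diffContOnCl (f.differentiableOn.mono fun z hz => hball ?_)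
  exact Metric.closure_ball_subset_closedBall hz

theorem exists_time {c x : ℝ} (hc : 0 < c) : ∃ T > 0, c * (x ^ 2)⁻¹ ≤ T ∧ T * x ^ 2 ≤ c := by
  rcases eq_or_ne x 0 with rfl | hx
  · exact ⟨1, one_pos, by simp, by simpa using hc.le⟩
  · have hx2 : 0 < x ^ 2 := by positivity
    exact ⟨c * (x ^ 2)⁻¹, by positivity, le_rfl, by
      rw [mul_assoc, inv_mul_cancel₀ hx2.ne', mul_one]⟩

/-- Lemma 5.1 of the paper: local well-posedness of the truncated resonant system in
`h^s(ℤ²)` for `s > 1` on a time interval `T ≳ ‖u⁰‖_s^{−2}`, with a unique continuous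
`h^s`-valued solution whose coordinates are real-analytic in time with uniform
factorial derivative bounds. -/
theorem stmt_16 (s : ℝ) (hs : 1 < s) :
    ∃ c > (0 : ℝ), ∀ ω : ℝ × ℝ, 0 < ω.1 → 0 < ω.2 → IsIrrationalPair ω → ∀ N : ℕ,
      ∀ u0 : ℤ × ℤ → ℂ, InHs s u0 →
        ∃ T > (0 : ℝ), c * ((hsNorm s u0) ^ 2)⁻¹ ≤ T ∧
          ∃ u : ℝ → (ℤ × ℤ) → ℂ,
            u 0 = u0 ∧
            (∀ t ∈ Set.Icc (0 : ℝ) T, InHs s (u t)) ∧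
            HsContOn s T u ∧
            SolvesTruncated ω N T u ∧
            (∀ v : ℝ → (ℤ × ℤ) → ℂ, v 0 = u0 →
              (∀ t ∈ Set.Icc (0 : ℝ) T, InHs s (v t)) → HsContOn s T v →
              SolvesTruncated ω N T v → ∀ t ∈ Set.Icc (0 : ℝ) T, v t = u t) ∧
            (∀ k : ℤ × ℤ, ∀ t ∈ Set.Icc (0 : ℝ) T,
              AnalyticAt ℝ (fun τ => u τ k) t) ∧
            ∃ C > (0 : ℝ), ∃ R > (0 : ℝ), ∀ k : ℤ × ℤ, ∀ n : ℕ,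
              ∀ τ ∈ Set.Icc (0 : ℝ) T,
                ‖iteratedDerivWithin n (fun τ' => u τ' k) (Set.Icc (0 : ℝ) T) τ‖ ≤
                  C * R ^ n * n.factorial := by

  obtain ⟨c, hc, hsol⟩ := exists_holomorphic_solution hs
  refine ⟨c, hc, fun ω _ _ _ N u0 hu0 => ?_⟩
  obtain ⟨T, hT, hcT, hTc⟩ := exists_time (x := hsNorm s u0) hc
  obtain ⟨U, hU, hU0, hUd⟩ := hsol ω N u0 hu0 T hT hTc
  have hmem {t : ℝ} (ht : t ∈ Set.Icc 0 T) := ofReal_mem_timeStrip hT ht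
  have hle (t) (ht : t ∈ Set.Icc 0 T) (k) : ‖(U k).eval t‖ ≤ ‖U k‖ := (U k).norm_eval_le (hmem ht)
  have hin (t) (ht : t ∈ Set.Icc 0 T) : InHs s fun k => (U k).eval t :=
    inHs_iff.2 (ne_top_of_le_ne_top hU
      (sobSq_mono fun k => enorm_le_iff_norm_le.2 (hle t ht k)))
  have hUsq : Summable fun k => ‖U k‖ ^ 2 * hsWeight s k := by
    have hn (k) : ‖((‖U k‖ : ℝ) : ℂ)‖ₑ = ‖U k‖ₑ := by
      rw [← ofReal_norm, Complex.norm_real, norm_norm, ofReal_norm]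
    have h := inHs_iff (s := s) (x := fun k => (‖U k‖ : ℂ)) |>.2 (by simpa only [hn] using hU)
    simpa only [InHs, Complex.norm_real, norm_norm] using h
  have hUbdd : ∃ C > 0, ∀ k, ‖U k‖ ≤ C := by
    have h := tsum_enorm_ne_top_iff_summable_norm.1 (tsum_ne_top_of_sobSq hs hU)
    refine ⟨∑' k, ‖U k‖ + 1, by positivity, fun k => ?_⟩
    have := h.le_tsum k fun _ _ => norm_nonneg _
    linarith
  have hcont : HsContOn s T fun t k => (U k).eval t :=
    hsContOn_of_continuousOn hUsq hle fun k t ht =>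
      (hUd k t (hmem ht)).comp_ofReal.continuousAt.continuousWithinAt
  have hsolves : SolvesTruncated ω N T fun t k => (U k).eval t := by
    intro t ht k
    have hfin := tsum_ne_top_of_sobSq hs (inHs_iff.1 (hin t ht))
    refine ⟨summable_norm_monom hfin Set.subset_union_left,
      summable_norm_monom hfin Set.subset_union_right, ?_⟩
    rw [← tsum_nonlinTerm ω N k hfin]
    exact (hUd k t (hmem ht)).comp_ofReal.hasDerivWithinAt
  have han (k) (t) (ht : t ∈ Set.Icc 0 T) : AnalyticAt ℂ (U k).eval (t : ℝ) :=
    (U k).analyticAt (isOpen_timeStrip T) (hmem ht)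
  obtain ⟨C, hC, hUC⟩ := hUbdd
  have hu00 : (fun k => (U k).eval (0 : ℝ)) = u0 := funext fun k => by
    rw [Complex.ofReal_zero, hU0]
  refine ⟨T, hT, hcT, fun t k => (U k).eval t, hu00, hin, hcont, hsolves,
    fun v hv0 hv hvc hvs => hvs.unique hs (hv0.trans hu00.symm) hv hvc hin hcont hsolves,
    fun k t ht => analyticAt_comp_ofReal (han k t ht), C, hC, (min 1 T / 2)⁻¹, by positivity,
    fun k n τ hτ => ?_⟩
  rw [iteratedDerivWithin_comp_ofReal hT (han k) n τ hτ]
  refine (norm_iteratedDeriv_eval_le hT (U k) n hτ).trans ?_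
  rw [inv_pow, div_eq_mul_inv, mul_comm (n.factorial : ℝ), mul_right_comm]
  gcongr
  exact hUC k
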